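/- arXiv:2210.15175 — 2 statements merged into one kernel-verified Lean document; each statement's English description precedes it below -/
import Mathlib

section
/- There is a universal constant c > 0 such that the following holds. Let w ≤ h be positive integers with h ≥ 3w, let X = {1,...,w} × {1,...,h} be the grid poset with the product order ((x,y) ≤ (x',y') iff x ≤ x' and y ≤ y'), let ℓ be an R-distance-based loss function, let n ≥ 1, ε ∈ (0,1] and 0 ≤ δ ≤ 0.01·ε·w/h. Then for every (ε,δ)-differentially private randomized algorithm M mapping datasets D ∈ (X×[0,1])^n to probability distributions over monotone functions f : X → [0,1], there exists a dataset D such that the expected excess empirical risk E_{f∼M(D)}[L_ℓ(f;D)] − min_{g monotone} L_ℓ(g;D) is at least c · R · min{1, w·log(h/w)/(εn)}. -/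
open MeasureTheory

noncomputable section

/-- The (normalized) empirical risk of `f` on dataset `D` with loss `ℓ`. -/
def empRisk {X : Type*} (ℓ : ℝ → ℝ → ℝ) {n : ℕ} (f : X → ℝ) (D : Fin n → X × ℝ) : ℝ :=
  (1 / (n : ℝ)) * ∑ i, ℓ (f (D i).1) (D i).2

/-- A valid dataset: all labels lie in `[0,1]`. -/
def IsDataset {X : Type*} {n : ℕ} (D : Fin n → X × ℝ) : Prop :=
  ∀ i, (D i).2 ∈ Set.Icc (0 : ℝ) 1

/-- Two (valid) datasets are neighboring if they differ in at most one entry. -/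
def NeighborDS {X : Type*} {n : ℕ} (D D' : Fin n → X × ℝ) : Prop :=
  IsDataset D ∧ IsDataset D' ∧ ∃ i, ∀ j, j ≠ i → D j = D' j

/-- A monotone function on the poset `X` taking values in `[0,1]`. -/
def IsMonotone01 {X : Type*} [PartialOrder X] (f : X → ℝ) : Prop :=
  Monotone f ∧ ∀ x, f x ∈ Set.Icc (0 : ℝ) 1

/-- The optimal empirical risk over all monotone `[0,1]`-valued functions. -/
def optRisk {X : Type*} [PartialOrder X] (ℓ : ℝ → ℝ → ℝ) {n : ℕ} (D : Fin n → X × ℝ) : ℝ :=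
  ⨅ g : {g : X → ℝ // IsMonotone01 g}, empRisk ℓ g.1 D

/-- `(ε, δ)`-differential privacy of a mechanism `M` w.r.t. a neighboring relation. -/
def IsDP {I Ω : Type*} [MeasurableSpace Ω] (Neighbor : I → I → Prop)
    (M : I → Measure Ω) (ε δ : ℝ) : Prop :=
  ∀ D D', Neighbor D D' → ∀ S : Set Ω, MeasurableSet S →
    M D S ≤ ENNReal.ofReal (Real.exp ε) * M D' S + ENNReal.ofReal δ

/-- A loss function `ℓ : [0,1] × [0,1] → ℝ≥0` that is `L`-Lipschitz in its first argument. -/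
def IsLipschitzLoss (ℓ : ℝ → ℝ → ℝ) (L : ℝ) : Prop :=
  (∀ y z : ℝ, y ∈ Set.Icc (0:ℝ) 1 → z ∈ Set.Icc (0:ℝ) 1 → 0 ≤ ℓ y z) ∧
  (∀ y y' z : ℝ, y ∈ Set.Icc (0:ℝ) 1 → y' ∈ Set.Icc (0:ℝ) 1 → z ∈ Set.Icc (0:ℝ) 1 →
    |ℓ y z - ℓ y' z| ≤ L * |y - y'|)

/-- An `R`-distance-based loss function: `ℓ(y,y') = g(|y - y'|)` for a non-decreasing
nonnegative `g` with `g 0 = 0` and `g (1/2) ≥ R`. -/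
def IsDistanceBasedLoss (ℓ : ℝ → ℝ → ℝ) (R : ℝ) : Prop :=
  ∃ g : ℝ → ℝ, MonotoneOn g (Set.Icc (0:ℝ) 1) ∧ (∀ t ∈ Set.Icc (0:ℝ) 1, 0 ≤ g t) ∧
    g 0 = 0 ∧ R ≤ g (1 / 2) ∧
    ∀ y y' : ℝ, y ∈ Set.Icc (0:ℝ) 1 → y' ∈ Set.Icc (0:ℝ) 1 → ℓ y y' = g |y - y'|

/-- The width of a poset: the largest size of an antichain. -/
def posetWidth (X : Type*) [PartialOrder X] : ℕ :=
  sSup {k | ∃ A : Finset X, IsAntichain (· ≤ ·) (A : Set X) ∧ A.card = k}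

/-- An isotonic-regression mechanism: on each valid dataset it outputs a probability
distribution supported on monotone `[0,1]`-valued functions. -/
def IsIsoRegAlg {X : Type*} [PartialOrder X] {n : ℕ}
    (M : (Fin n → X × ℝ) → Measure (X → ℝ)) : Prop :=
  ∀ D : Fin n → X × ℝ, IsDataset D →
    IsProbabilityMeasure (M D) ∧ M D {f | IsMonotone01 f} = 1

theorem measurableSet_isMonotone01 {X : Type*} [PartialOrder X] [Finite X] :
    MeasurableSet {f : X → ℝ | IsMonotone01 f} := by
  have h : IsClosed {f : X → ℝ | IsMonotone01 f} := by
    have h2 : IsClosed (⋂ x : X, (fun f : X → ℝ => f x) ⁻¹' Set.Icc (0 : ℝ) 1) :=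
      isClosed_iInter fun x => isClosed_Icc.preimage (continuous_apply x)
    have h1 : IsClosed {f : X → ℝ | Monotone f} := isClosed_monotone
    convert h1.inter h2 using 1
    ext f
    simp [IsMonotone01]
  exact h.measurableSet

theorem IsIsoRegAlg.ae_isMonotone01 {X : Type*} [PartialOrder X] [Finite X] {n : ℕ}
    {M : (Fin n → X × ℝ) → Measure (X → ℝ)} (hM : IsIsoRegAlg M) {D : Fin n → X × ℝ}
    (hD : IsDataset D) : ∀ᵐ f ∂(M D), IsMonotone01 f := by
  have := (hM D hD).1
  exact (prob_compl_eq_zero_iff measurableSet_isMonotone01).2 (hM D hD).2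

theorem abs_sub_mem_Icc_zero_one {y z : ℝ} (hy : y ∈ Set.Icc (0 : ℝ) 1)
    (hz : z ∈ Set.Icc (0 : ℝ) 1) : |y - z| ∈ Set.Icc (0 : ℝ) 1 :=
  ⟨abs_nonneg _, abs_le.2 ⟨by linarith [hy.1, hz.2], by linarith [hy.2, hz.1]⟩⟩

namespace IsDistanceBasedLoss

variable {ℓ : ℝ → ℝ → ℝ} {R : ℝ}

theorem nonneg (hℓ : IsDistanceBasedLoss ℓ R) {y z : ℝ} (hy : y ∈ Set.Icc (0 : ℝ) 1)
    (hz : z ∈ Set.Icc (0 : ℝ) 1) : 0 ≤ ℓ y z := by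
  obtain ⟨g, -, h0, -, -, h⟩ := hℓ
  rw [h y z hy hz]
  exact h0 _ (abs_sub_mem_Icc_zero_one hy hz)

theorem self_eq_zero (hℓ : IsDistanceBasedLoss ℓ R) {y : ℝ} (hy : y ∈ Set.Icc (0 : ℝ) 1) :
    ℓ y y = 0 := by
  obtain ⟨g, -, -, h0, -, h⟩ := hℓ
  rw [h y y hy hy, sub_self, abs_zero, h0]

theorem le_of_half_le (hℓ : IsDistanceBasedLoss ℓ R) {y z : ℝ} (hy : y ∈ Set.Icc (0 : ℝ) 1)
    (hz : z ∈ Set.Icc (0 : ℝ) 1) (hyz : 1 / 2 ≤ |y - z|) : R ≤ ℓ y z := by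
  obtain ⟨g, hg, -, -, hR, h⟩ := hℓ
  rw [h y z hy hz]
  exact hR.trans (hg (by norm_num) (abs_sub_mem_Icc_zero_one hy hz) hyz)

theorem empRisk_nonneg {X : Type*} [PartialOrder X] {n : ℕ} (hℓ : IsDistanceBasedLoss ℓ R)
    {D : Fin n → X × ℝ} (hD : IsDataset D) {f : X → ℝ} (hf : IsMonotone01 f) :
    0 ≤ empRisk ℓ f D :=
  mul_nonneg (by positivity) (Finset.sum_nonneg fun i _ => hℓ.nonneg (hf.2 _) (hD i))

theorem optRisk_nonpos {X : Type*} [PartialOrder X] {n : ℕ} (hℓ : IsDistanceBasedLoss ℓ R)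
    {D : Fin n → X × ℝ} (hD : IsDataset D) {f : X → ℝ} (hf : IsMonotone01 f)
    (hfit : ∀ i, f (D i).1 = (D i).2) : optRisk ℓ D ≤ 0 := by
  have h0 : empRisk ℓ f D = 0 := by
    simp [empRisk, hfit, fun i => hℓ.self_eq_zero (hD i)]
  rw [← h0]
  refine ciInf_le (f := fun g : {g : X → ℝ // IsMonotone01 g} => empRisk ℓ g.1 D) ⟨0, ?_⟩ ⟨f, hf⟩
  rintro _ ⟨g, rfl⟩
  exact hℓ.empRisk_nonneg hD g.2

theorem integrable_empRisk {X : Type*} [PartialOrder X] [Finite X] {n : ℕ}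
    (hℓ : IsDistanceBasedLoss ℓ R)
    {M : (Fin n → X × ℝ) → Measure (X → ℝ)} (hM : IsIsoRegAlg M) {D : Fin n → X × ℝ}
    (hD : IsDataset D) : Integrable (fun f => empRisk ℓ f D) (M D) := by
  have := (hM D hD).1
  obtain ⟨g, hg, h0, -, -, h⟩ := hℓ
  refine Integrable.const_mul (integrable_finsetSum _ fun i _ => ?_) _
  set G : ℝ → ℝ := Set.IccExtend zero_le_one ((Set.Icc (0 : ℝ) 1).domRestrict g)
  have hG : Measurable G := (Monotone.IccExtend _ hg.monotone).measurable
  have hGm : Measurable fun f : X → ℝ => G |f (D i).1 - (D i).2| :=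
    hG.comp (((measurable_pi_apply _).sub_const _).abs)
  have hae : (fun f : X → ℝ => G |f (D i).1 - (D i).2|) =ᵐ[M D]
      fun f => ℓ (f (D i).1) (D i).2 := by
    filter_upwards [hM.ae_isMonotone01 hD] with f hf
    rw [h _ _ (hf.2 _) (hD i)]
    exact Set.IccExtend_of_mem _ _ (abs_sub_mem_Icc_zero_one (hf.2 _) (hD i))
  refine (Integrable.of_bound hGm.aestronglyMeasurable (g 1) (ae_of_all _ fun f => ?_)).congr hae
  simp only [G, Set.IccExtend, Function.comp_apply, Set.domRestrict_apply]
  have hp := (Set.projIcc (0 : ℝ) 1 zero_le_one |f (D i).1 - (D i).2|).2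
  rw [Real.norm_eq_abs, abs_of_nonneg (h0 _ hp)]
  exact hg hp (by norm_num) hp.2

end IsDistanceBasedLoss

/-- Group privacy: changing the entries in `s` degrades the guarantee to
`(#s * ε, (exp (#s * ε) - 1) * δ / ε)`. -/
theorem IsDP.group_privacy {X Ω : Type*} [MeasurableSpace Ω] {n : ℕ}
    {M : (Fin n → X × ℝ) → Measure Ω} {ε δ : ℝ} (hε : 0 < ε) (hδ : 0 ≤ δ)
    (hM : IsDP NeighborDS M ε δ) (hprob : ∀ D, IsDataset D → IsProbabilityMeasure (M D))
    {S : Set Ω} (hS : MeasurableSet S) (s : Finset (Fin n)) {D D' : Fin n → X × ℝ}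
    (hD : IsDataset D) (hD' : IsDataset D') (h : ∀ i ∉ s, D i = D' i) :
    (M D).real S ≤ Real.exp (s.card * ε) * (M D').real S
      + (Real.exp (s.card * ε) - 1) * (δ / ε) := by
  induction s using Finset.induction_on generalizing D with
  | empty =>
    obtain rfl : D = D' := funext fun i => h i (by simp)
    simp
  | insert a s ha ih =>
    set D₁ := Function.update D a (D' a)
    have hD₁ : IsDataset D₁ := by
      intro i
      by_cases hi : i = a
      · subst hi; simpa [D₁] using hD' i
      · simpa [D₁, hi] using hD i
    have hind := ih hD₁ fun i hi => by
      by_cases hia : i = a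
      · subst hia; simp [D₁]
      · simpa [D₁, hia] using h i (by simp [hi, hia])
    have hstep : (M D).real S ≤ Real.exp ε * (M D₁).real S + δ := by
      have := hprob D₁ hD₁
      have h1 := hM D D₁ ⟨hD, hD₁, a, fun j hj => by simp [D₁, hj]⟩ S hS
      have h2 := ENNReal.toReal_mono (by finiteness) h1
      rwa [ENNReal.toReal_add (by finiteness) (by finiteness), ENNReal.toReal_mul,
        ENNReal.toReal_ofReal (Real.exp_nonneg _), ENNReal.toReal_ofReal hδ] at h2
    rw [Finset.card_insert_of_notMem ha]
    push_cast
    rw [show ((s.card : ℝ) + 1) * ε = ε + s.card * ε by ring, Real.exp_add]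
    have h1 := mul_le_mul_of_nonneg_left hind (Real.exp_nonneg ε)
    have h2 : δ ≤ (Real.exp ε - 1) * (δ / ε) := by
      have : ε * (δ / ε) = δ := by field_simp
      nlinarith [Real.add_one_le_exp ε, div_nonneg hδ hε.le]
    linarith

/-- Packing bound, averaged over a product of packings: some configuration `v` has a large
expected number of coordinates `i` for which the event `E i (v i)` fails. -/
theorem exists_le_sum_one_sub_measureReal {Ω ι T : Type*} [MeasurableSpace Ω] [Fintype ι]
    [DecidableEq ι] [Fintype T] [Nonempty T] (P : (ι → T) → Measure Ω)
    [∀ v, IsProbabilityMeasure (P v)] (E : ι → T → Set Ω) (hE : ∀ i a, MeasurableSet (E i a))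
    (hdisj : ∀ i, Pairwise fun a b => Disjoint (E i a) (E i b)) {A B : ℝ} (hA : 0 < A)
    (hP : ∀ v i b S, MeasurableSet S →
      (P (Function.update v i b)).real S ≤ A * (P v).real S + B) :
    ∃ v, (Fintype.card ι : ℝ) * ((Fintype.card T - 1 : ℝ) * (1 - B)) ≤
      (A + (Fintype.card T - 1)) * ∑ i, (1 - (P v).real (E i (v i))) := by
  classical
  set t : ℝ := (Fintype.card T : ℝ)
  have ht : (1 : ℝ) ≤ t := Nat.one_le_cast.2 Fintype.card_pos
  suffices h : ∑ v : ι → T, (Fintype.card ι : ℝ) * ((t - 1) * (1 - B)) ≤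
      ∑ v, (A + (t - 1)) * ∑ i, (1 - (P v).real (E i (v i))) by
    obtain ⟨v, -, hv⟩ := Finset.exists_le_of_sum_le Finset.univ_nonempty h
    exact ⟨v, hv⟩
  have hkey : ∀ i, ∑ v : ι → T, (t - 1) * (1 - B) ≤
      ∑ v, (A + (t - 1)) * (1 - (P v).real (E i (v i))) := by
    intro i
    have hswap : ∑ v : ι → T, ∑ b, (P (Function.update v i b)).real (E i b) =
        ∑ v : ι → T, ∑ _b : T, (P v).real (E i (v i)) := by
      rw [← Fintype.sum_prod_type', ← Fintype.sum_prod_type']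
      let φ : (ι → T) × T → (ι → T) × T := fun p => (Function.update p.1 i p.2, p.1 i)
      have hφ : Function.Involutive φ := fun p => by simp [φ]
      rw [← Equiv.sum_comp hφ.toPerm (fun p : (ι → T) × T => (P p.1).real (E i (p.1 i)))]
      simp [φ]
    have hrow : ∀ v : ι → T, ∑ b, (P (Function.update v i b)).real (E i b) ≤
        (P v).real (E i (v i)) + A * (1 - (P v).real (E i (v i))) + (t - 1) * B := by
      intro v
      have htot : ∑ b, (P v).real (E i b) ≤ 1 := by
        rw [← measureReal_iUnion_fintype (hdisj i) (hE i)]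
        exact measureReal_le_one
      rw [← Finset.add_sum_erase _ _ (Finset.mem_univ (v i))] at htot ⊢
      have hsum : ∑ b ∈ Finset.univ.erase (v i), (P (Function.update v i b)).real (E i b) ≤
          A * ∑ b ∈ Finset.univ.erase (v i), (P v).real (E i b) + (t - 1) * B := by
        refine (Finset.sum_le_sum fun b _ => hP v i b _ (hE i b)).trans_eq ?_
        rw [Finset.sum_add_distrib, ← Finset.mul_sum, Finset.sum_const,
          Finset.card_erase_of_mem (Finset.mem_univ _), Finset.card_univ, nsmul_eq_mul,
          Nat.cast_pred Fintype.card_pos]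
      rw [Function.update_eq_self]
      nlinarith
    have hall := Finset.sum_le_sum fun v (_ : v ∈ Finset.univ) => hrow v
    rw [hswap] at hall
    rw [← sub_nonneg, ← Finset.sum_sub_distrib] at hall ⊢
    refine hall.trans_eq (Finset.sum_congr rfl fun v _ => ?_)
    rw [Finset.sum_const, Finset.card_univ, nsmul_eq_mul]
    ring
  simp_rw [Finset.mul_sum]
  rw [Finset.sum_comm]
  refine le_trans (le_of_eq ?_) (Finset.sum_le_sum fun i _ => hkey i)
  simp only [Finset.sum_const, Finset.card_univ, nsmul_eq_mul]
  ring

/-- A family of realizable datasets whose solutions fall into disjoint events forces every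
private mechanism to have large excess risk on one of them. -/
theorem exists_excess_risk_ge_of_packing {X ι T : Type*} [PartialOrder X] [Finite X] [Fintype ι]
    [DecidableEq ι] [Fintype T] [Nonempty T] {n N : ℕ} {ℓ : ℝ → ℝ → ℝ} {R ε δ κ : ℝ}
    (hℓ : IsDistanceBasedLoss ℓ R) (hε : 0 < ε) (hδ : 0 ≤ δ)
    {M : (Fin n → X × ℝ) → Measure (X → ℝ)} (hM : IsIsoRegAlg M) (hDP : IsDP NeighborDS M ε δ)
    (D : (ι → T) → Fin n → X × ℝ) (hD : ∀ v, IsDataset (D v))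
    (hopt : ∀ v, optRisk ℓ (D v) ≤ 0)
    (hnear : ∀ v i b, ∃ s : Finset (Fin n), s.card ≤ N ∧
      ∀ p ∉ s, D (Function.update v i b) p = D v p)
    (E : ι → T → Set (X → ℝ)) (hE : ∀ i a, MeasurableSet (E i a))
    (hdisj : ∀ i, Pairwise fun a b => Disjoint (E i a) (E i b)) (hκ : 0 ≤ κ)
    (hrisk : ∀ v f, IsMonotone01 f →
      κ * ∑ i, ((E i (v i))ᶜ).indicator (fun _ => (1 : ℝ)) f ≤ empRisk ℓ f (D v))
    (hcard : Real.exp (N * ε) ≤ 23 * (Fintype.card T - 1))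
    (hsmall : Real.exp (N * ε) * (δ / ε) ≤ 1 / 2) :
    ∃ D : Fin n → X × ℝ, IsDataset D ∧
      κ * Fintype.card ι / 48 ≤ (∫ f, empRisk ℓ f D ∂(M D)) - optRisk ℓ D := by
  have hprob : ∀ v, IsProbabilityMeasure (M (D v)) := fun v => (hM _ (hD v)).1
  have hδε : 0 ≤ δ / ε := div_nonneg hδ hε.le
  obtain ⟨v, hv⟩ := exists_le_sum_one_sub_measureReal (fun v => M (D v)) E hE hdisj
    (A := Real.exp (N * ε)) (B := 1 / 2) (Real.exp_pos _) (fun v i b S hS => by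
      obtain ⟨s, hs, hsD⟩ := hnear v i b
      have h1 := hDP.group_privacy hε hδ (fun D hD => (hM D hD).1) hS s (hD _) (hD v) hsD
      have h2 : Real.exp (s.card * ε) ≤ Real.exp (N * ε) :=
        Real.exp_le_exp.2 (mul_le_mul_of_nonneg_right (Nat.cast_le.2 hs) hε.le)
      have h3 := mul_le_mul_of_nonneg_right h2 (measureReal_nonneg (μ := M (D v)) (s := S))
      have h4 := mul_le_mul_of_nonneg_right h2 hδε
      linarith)
  refine ⟨D v, hD v, ?_⟩
  have hint : ∀ i, Integrable (((E i (v i))ᶜ).indicator fun _ => (1 : ℝ)) (M (D v)) :=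
    fun i => (integrable_const _).indicator (hE _ _).compl
  have hle : κ * ∑ i, (1 - (M (D v)).real (E i (v i))) ≤ ∫ f, empRisk ℓ f (D v) ∂(M (D v)) := by
    calc κ * ∑ i, (1 - (M (D v)).real (E i (v i)))
        = ∫ f, κ * ∑ i, ((E i (v i))ᶜ).indicator (fun _ => (1 : ℝ)) f ∂(M (D v)) := by
          rw [integral_const_mul, integral_finsetSum _ fun i _ => hint i]
          congr 1
          refine Finset.sum_congr rfl fun i _ => ?_
          rw [integral_indicator_const _ (hE _ _).compl, probReal_compl_eq_one_sub (hE _ _),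
            smul_eq_mul, mul_one]
      _ ≤ _ := integral_mono_ae ((integrable_finsetSum _ fun i _ => hint i).const_mul _)
          (hℓ.integrable_empRisk hM (hD v))
          ((hM.ae_isMonotone01 (hD v)).mono fun f hf => hrisk v f hf)
  set err := ∑ i, (1 - (M (D v)).real (E i (v i)))
  have herr : 0 ≤ err := Finset.sum_nonneg fun i _ => sub_nonneg.2 measureReal_le_one
  have hτ : (0 : ℝ) < Fintype.card T - 1 := by linarith [Real.exp_pos (N * ε)]
  have hbound : (Fintype.card ι : ℝ) / 48 ≤ err := by
    have h1 := mul_le_mul_of_nonneg_right hcard herr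
    refine le_of_mul_le_mul_left ?_ hτ
    linarith
  have := mul_le_mul_of_nonneg_left hbound hκ
  linarith [hopt v]

theorem exists_excess_risk_ge_of_single_sample {X : Type*} [PartialOrder X] [Finite X]
    [Nonempty X] {ℓ : ℝ → ℝ → ℝ} {R ε δ : ℝ} (hℓ : IsDistanceBasedLoss ℓ R) (hR : 0 ≤ R)
    (hε : 0 < ε) (hε1 : ε ≤ 1) (hδ : 0 ≤ δ) (hδε : δ / ε ≤ 1 / 6)
    {M : (Fin 1 → X × ℝ) → Measure (X → ℝ)} (hM : IsIsoRegAlg M) (hDP : IsDP NeighborDS M ε δ) :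
    ∃ D : Fin 1 → X × ℝ, IsDataset D ∧
      R / 48 ≤ (∫ f, empRisk ℓ f D ∂(M D)) - optRisk ℓ D := by
  obtain ⟨x⟩ := ‹Nonempty X›
  have hexp : Real.exp ((1 : ℕ) * ε) ≤ 3 := by
    have h1 : Real.exp ((1 : ℕ) * ε) ≤ Real.exp 1 := Real.exp_le_exp.2 (by simpa using hε1)
    linarith [Real.exp_one_lt_d9]
  let y : Bool → ℝ := fun b => if b then 1 else 0
  have hy : ∀ b, y b ∈ Set.Icc (0 : ℝ) 1 := by intro b; cases b <;> simp [y]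
  have hDv : ∀ v : Unit → Bool, IsDataset fun _ : Fin 1 => (x, y (v ())) := fun v _ => hy _
  have hm : ∀ b : Bool, MeasurableSet {f : X → ℝ | (1 / 2 ≤ f x) ↔ b = true} := by
    have h : MeasurableSet {f : X → ℝ | 1 / 2 ≤ f x} :=
      measurableSet_le measurable_const (measurable_pi_apply x)
    intro b
    cases b
    · simp only [Bool.false_eq_true, iff_false]
      exact h.compl
    · simp only [iff_true]
      exact h
  obtain ⟨D, hD, h⟩ := exists_excess_risk_ge_of_packing (ι := Unit) (T := Bool) (N := 1) (κ := R)
    hℓ hε hδ hM hDP (fun v _ => (x, y (v ()))) hDv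
    (fun v => hℓ.optRisk_nonpos (hDv v) (f := fun _ => y (v ()))
      ⟨monotone_const, fun _ => hy _⟩ fun _ => rfl)
    (fun v i b => ⟨{0}, by simp, fun p hp => absurd (Subsingleton.elim p 0) (by simpa using hp)⟩)
    (fun _ b => {f | (1 / 2 ≤ f x) ↔ b = true}) (fun _ b => hm b)
    (fun _ a b hab => Set.disjoint_left.2 fun f ha hb => hab (Bool.eq_iff_iff.2 (ha.symm.trans hb)))
    hR
    (fun v f hf => by
      have h0 := hℓ.nonneg (hf.2 x) (hy (v ()))
      have hfx := hf.2 x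
      rw [empRisk, Fintype.sum_unique, Nat.cast_one, div_one, one_mul]
      by_cases hfe : (1 / 2 ≤ f x) ↔ v () = true
      · rw [Fintype.sum_unique, Set.indicator_of_notMem (not_not.2 (by exact hfe)), mul_zero]
        exact h0
      · have hR' : R ≤ ℓ (f x) (y (v ())) := by
          refine hℓ.le_of_half_le hfx (hy _) ?_
          cases hv : v ()
          · have : 1 / 2 ≤ f x := by simpa [hv] using hfe
            simpa [y, abs_of_nonneg hfx.1] using this
          · have : f x < 1 / 2 := by simpa [hv] using hfe
            rw [abs_sub_comm]
            refine le_trans ?_ (le_abs_self _)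
            simp only [y, if_true]
            linarith
        rw [Fintype.sum_unique, Set.indicator_of_mem (by exact hfe), mul_one]
        exact hR')
    (by simp only [Fintype.card_bool, Nat.cast_ofNat]; linarith)
    (by
      have := mul_le_mul hexp hδε (div_nonneg hδ hε.le) (by norm_num)
      linarith)
  exact ⟨D, hD, by simpa using h⟩

/-- The packing construction on `W` pairwise incomparable chains of length `t + 1`. -/
theorem exists_excess_risk_ge_of_chains {X : Type*} [PartialOrder X] [Finite X]
    {n W t k : ℕ} [NeZero W] [NeZero t] (pt : Fin W → Fin (t + 1) → X)
    (hpt : ∀ i a j b, pt i a ≤ pt j b → i = j ∧ a ≤ b)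
    (hmono : ∀ i, Monotone (pt i))
    (hn : 2 * (k * W) ≤ n) {ℓ : ℝ → ℝ → ℝ} {R ε δ : ℝ} (hℓ : IsDistanceBasedLoss ℓ R)
    (hR : 0 ≤ R) (hε : 0 < ε) (hδ : 0 ≤ δ)
    {M : (Fin n → X × ℝ) → Measure (X → ℝ)} (hM : IsIsoRegAlg M) (hDP : IsDP NeighborDS M ε δ)
    (hcard : Real.exp ((2 * k : ℕ) * ε) ≤ 23 * (t - 1))
    (hsmall : Real.exp ((2 * k : ℕ) * ε) * (δ / ε) ≤ 1 / 2) :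
    ∃ D : Fin n → X × ℝ, IsDataset D ∧
      1 / n * (k * R) * W / 48 ≤ (∫ f, empRisk ℓ f D ∂(M D)) - optRisk ℓ D := by
  classical
  obtain ⟨φ⟩ : Nonempty (Fin W × Fin k × Bool ↪ Fin n) := by
    refine Function.Embedding.nonempty_of_card_le ?_
    simp only [Fintype.card_prod, Fintype.card_fin, Fintype.card_bool]
    linarith
  let smp : (Fin W → Fin t) → Fin W × Fin k × Bool → X × ℝ := fun v q =>
    if q.2.2 then (pt q.1 (v q.1).succ, 1) else (pt q.1 (v q.1).castSucc, 0)
  let dflt : X × ℝ := (pt 0 (Fin.last t), 1)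
  let D : (Fin W → Fin t) → Fin n → X × ℝ := fun v => Function.extend φ (smp v) fun _ => dflt
  have hDφ : ∀ v q, D v (φ q) = smp v q := fun v q => φ.injective.extend_apply _ _ _
  have hDout : ∀ v p, (¬ ∃ q, φ q = p) → D v p = dflt := fun v p hp =>
    Function.extend_apply' _ _ _ hp
  have hD : ∀ v, IsDataset (D v) := by
    intro v p
    by_cases hp : ∃ q, φ q = p
    · obtain ⟨⟨i, j, b⟩, rfl⟩ := hp
      rw [hDφ]
      cases b <;> simp [smp]
    · rw [hDout v p hp]
      simp [dflt]
  have hopt : ∀ v, optRisk ℓ (D v) ≤ 0 := by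
    intro v
    refine hℓ.optRisk_nonpos (hD v)
      (f := fun x => if ∃ i, x ≤ pt i (v i).castSucc then 0 else 1) ⟨?_, ?_⟩ ?_
    · intro x y hxy
      dsimp only
      split_ifs with hx hy hy
      · exact le_rfl
      · exact zero_le_one
      · obtain ⟨i, hi⟩ := hy
        exact absurd ⟨i, hxy.trans hi⟩ hx
      · exact le_rfl
    · intro x
      dsimp only
      split_ifs <;> simp
    · intro p
      by_cases hp : ∃ q, φ q = p
      · obtain ⟨⟨i, j, b⟩, rfl⟩ := hp
        rw [hDφ]
        cases b
        · simp only [smp, Bool.false_eq_true, if_false]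
          exact if_pos ⟨i, le_rfl⟩
        · simp only [smp, if_true]
          refine if_neg ?_
          rintro ⟨i', h⟩
          obtain ⟨rfl, h⟩ := hpt _ _ _ _ h
          exact absurd h (not_le.2 Fin.castSucc_lt_succ)
      · rw [hDout v p hp]
        refine if_neg ?_
        rintro ⟨i', h⟩
        exact absurd (hpt _ _ _ _ h).2 (not_le.2 (Fin.castSucc_lt_last _))
  let E : Fin W → Fin t → Set (X → ℝ) := fun i a =>
    ⋂ b, {f | f (pt i b) < 1 / 2 ↔ b ≤ a.castSucc}
  have hE : ∀ i a, MeasurableSet (E i a) := by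
    refine fun i a => MeasurableSet.iInter fun b => ?_
    have h : MeasurableSet {f : X → ℝ | f (pt i b) < 1 / 2} :=
      measurableSet_lt (measurable_pi_apply _) measurable_const
    by_cases hb : b ≤ a.castSucc
    · simp only [hb, iff_true]
      exact h
    · simp only [hb, iff_false]
      exact h.compl
  have hdisj : ∀ i, Pairwise fun a b => Disjoint (E i a) (E i b) := by
    intro i a b hab
    refine Set.disjoint_left.2 fun f ha hb => hab ?_
    simp only [E, Set.mem_iInter, Set.mem_ofPred_eq] at ha hb
    have h1 := ((hb _).1 ((ha a.castSucc).2 le_rfl))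
    have h2 := ((ha _).1 ((hb b.castSucc).2 le_rfl))
    exact Fin.castSucc_injective _ (le_antisymm h1 h2)
  have hnear : ∀ v i b, ∃ s : Finset (Fin n), s.card ≤ 2 * k ∧
      ∀ p ∉ s, D (Function.update v i b) p = D v p := by
    intro v i b
    refine ⟨Finset.univ.image fun q : Fin k × Bool => φ (i, q), ?_, fun p hp => ?_⟩
    · refine Finset.card_image_le.trans (le_of_eq ?_)
      simp [mul_comm]
    · by_cases hq : ∃ q, φ q = p
      · obtain ⟨⟨i', q⟩, rfl⟩ := hq
        have hi : i' ≠ i := by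
          rintro rfl
          exact hp (Finset.mem_image_of_mem _ (Finset.mem_univ q))
        rw [hDφ, hDφ]
        simp [smp, hi]
      · rw [hDout _ p hq, hDout _ p hq]
  have hrisk : ∀ v f, IsMonotone01 f →
      1 / n * (k * R) * ∑ i, ((E i (v i))ᶜ).indicator (fun _ => (1 : ℝ)) f ≤
        empRisk ℓ f (D v) := by
    intro v f hf
    have hpair : ∀ i, R * ((E i (v i))ᶜ).indicator (fun _ => (1 : ℝ)) f ≤
        ℓ (f (pt i (v i).succ)) 1 + ℓ (f (pt i (v i).castSucc)) 0 := by
      intro i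
      have h0 := hf.2 (pt i (v i).castSucc)
      have h1 := hf.2 (pt i (v i).succ)
      have hz : (0 : ℝ) ∈ Set.Icc (0 : ℝ) 1 := by simp
      have ho : (1 : ℝ) ∈ Set.Icc (0 : ℝ) 1 := by simp
      have hℓ0 := hℓ.nonneg h0 hz
      have hℓ1 := hℓ.nonneg h1 ho
      by_cases hfE : f ∈ E i (v i)
      · simpa [hfE] using add_nonneg hℓ1 hℓ0
      · rw [Set.indicator_of_mem (by exact hfE), mul_one]
        by_cases hlow : f (pt i (v i).castSucc) < 1 / 2
        · by_cases hhigh : f (pt i (v i).succ) < 1 / 2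
          · have : R ≤ ℓ (f (pt i (v i).succ)) 1 := by
              refine hℓ.le_of_half_le h1 ho ?_
              rw [abs_sub_comm]
              exact le_trans (by linarith) (le_abs_self _)
            linarith
          · refine absurd (show f ∈ E i (v i) from
              Set.mem_iInter.2 fun b => Iff.intro (fun hb => ?_) fun hb => ?_) hfE
            · by_contra hba
              refine hhigh (lt_of_le_of_lt (hf.1 (hmono i ?_)) hb)
              exact Fin.castSucc_lt_iff_succ_le.1 (not_le.1 hba)
            · exact lt_of_le_of_lt (hf.1 (hmono i hb)) hlow
        · have : R ≤ ℓ (f (pt i (v i).castSucc)) 0 := by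
            refine hℓ.le_of_half_le h0 hz ?_
            rw [sub_zero]
            exact (not_lt.1 hlow).trans (le_abs_self _)
          linarith
    rw [mul_assoc]
    refine mul_le_mul_of_nonneg_left ?_ (by positivity)
    calc k * R * ∑ i, ((E i (v i))ᶜ).indicator (fun _ => (1 : ℝ)) f
        = ∑ i, ∑ _j : Fin k, R * ((E i (v i))ᶜ).indicator (fun _ => (1 : ℝ)) f := by
          simp only [Finset.sum_const, Finset.card_univ, Fintype.card_fin, nsmul_eq_mul,
            Finset.mul_sum, mul_assoc]
      _ ≤ ∑ i, ∑ _j : Fin k, (ℓ (f (pt i (v i).succ)) 1 + ℓ (f (pt i (v i).castSucc)) 0) :=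
          Finset.sum_le_sum fun i _ => Finset.sum_le_sum fun _ _ => hpair i
      _ = ∑ q : Fin W × Fin k × Bool, ℓ (f (D v (φ q)).1) (D v (φ q)).2 := by
          simp [Fintype.sum_prod_type, hDφ, smp]
      _ = ∑ p ∈ Finset.univ.map φ, ℓ (f (D v p).1) (D v p).2 := by
          rw [Finset.sum_map]
      _ ≤ ∑ p, ℓ (f (D v p).1) (D v p).2 :=
          Finset.sum_le_sum_of_subset_of_nonneg (Finset.subset_univ _) fun p _ _ =>
            hℓ.nonneg (hf.2 _) (hD v p)
  simpa using exists_excess_risk_ge_of_packing (N := 2 * k) hℓ hε hδ hM hDP D hD hopt hnear E hE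
    hdisj (κ := 1 / n * (k * R)) (by positivity) hrisk (by simpa using hcard) hsmall

/-- The grid contains `W ≤ w` pairwise incomparable chains of length `m`, provided `w * m ≤ h`. -/
theorem exists_incomparable_chains_grid {w h W m : ℕ} (hW : W ≤ w) (hm : w * m ≤ h) :
    ∃ pt : Fin W → Fin m → Fin w × Fin h,
      (∀ i a j b, pt i a ≤ pt j b → i = j ∧ a ≤ b) ∧ ∀ i, Monotone (pt i) := by
  have hlt : ∀ (i : Fin W) (a : Fin m), (w - 1 - i) * m + a < h := by
    intro i a
    have h1 : (w - 1 - (i : ℕ)) + 1 ≤ w := by omega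
    have h2 := Nat.mul_le_mul_right m h1
    rw [add_mul, one_mul] at h2
    omega
  refine ⟨fun i a => (⟨i, i.2.trans_le hW⟩, ⟨_, hlt i a⟩), ?_, ?_⟩
  · intro i a j b hab
    simp only [Prod.mk_le_mk, Fin.mk_le_mk] at hab
    obtain ⟨hij, hrow⟩ := hab
    rcases eq_or_lt_of_le hij with hij | hij
    · obtain rfl : i = j := Fin.ext hij
      exact ⟨rfl, Fin.le_def.2 (by omega)⟩
    · have h1 : (w - 1 - (j : ℕ)) + 1 ≤ w - 1 - i := by omega
      have h2 := Nat.mul_le_mul_right m h1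
      rw [add_mul, one_mul] at h2
      omega
  · intro i a b hab
    simpa [Prod.le_def] using hab

/-- Integer parameters for the packing: `W` chains with `2 * k` samples each, such that the
number of useful samples is a constant fraction of the claimed rate. -/
theorem exists_packing_parameters {w m n : ℕ} (hw : 1 ≤ w) (hm : 3 ≤ m) (hn : 2 ≤ n) {ε r : ℝ}
    (hε : 0 < ε) (hε1 : ε ≤ 1) (hr0 : 0 < r) (hr : r ≤ m + 1) :
    ∃ W k : ℕ, 1 ≤ W ∧ W ≤ w ∧ 2 * (k * W) ≤ n ∧ Real.exp ((2 * k : ℕ) * ε) ≤ 7.4 * m ∧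
      min 1 (w * Real.log r / (ε * n)) ≤ 4 * (k * W / n) := by
  have hm' : (3 : ℝ) ≤ m := by exact_mod_cast hm
  have hn' : (0 : ℝ) < n := by exact_mod_cast (by omega : 0 < n)
  have hw' : (1 : ℝ) ≤ w := by exact_mod_cast hw
  have hexp2 : Real.exp 2 ≤ 7.4 := by
    rw [show (2 : ℝ) = 1 + 1 by norm_num, Real.exp_add]
    nlinarith [Real.exp_one_lt_d9, Real.exp_pos 1]
  have hlogm : 0 < Real.log m := Real.log_pos (by linarith)
  have hexp : ∀ k : ℕ, (k : ℝ) ≤ 1 + Real.log m / (2 * ε) →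
      Real.exp ((2 * k : ℕ) * ε) ≤ 7.4 * m := by
    intro k hk
    have h1 : ((2 * k : ℕ) : ℝ) * ε ≤ 2 + Real.log m := by
      have h2 := mul_le_mul_of_nonneg_right hk (by positivity : 0 ≤ 2 * ε)
      have h3 : Real.log m / (2 * ε) * (2 * ε) = Real.log m := by field_simp
      push_cast
      linarith
    refine (Real.exp_le_exp.2 h1).trans ?_
    rw [Real.exp_add, Real.exp_log (by linarith)]
    exact mul_le_mul_of_nonneg_right hexp2 (by linarith)
  rcases lt_or_ge n (2 * w) with hnw | hnw
  · refine ⟨n / 2, 1, by omega, by omega, by omega, hexp 1 ?_, (min_le_left _ _).trans ?_⟩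
    · simp only [Nat.cast_one, le_add_iff_nonneg_right]; positivity
    · have : (n : ℝ) ≤ 4 * (n / 2 : ℕ) := by exact_mod_cast (by omega : n ≤ 4 * (n / 2))
      rw [← mul_div_assoc, le_div_iff₀ hn']
      push_cast at this ⊢
      linarith
  · set k₁ := n / (2 * w)
    set k₂ := ⌊Real.log m / (2 * ε)⌋₊ + 1
    have hfloor : (k₂ : ℝ) ≤ 1 + Real.log m / (2 * ε) := by
      have := Nat.floor_le (by positivity : 0 ≤ Real.log m / (2 * ε))
      simp only [k₂]
      push_cast
      linarith
    refine ⟨w, min k₁ k₂, hw, le_rfl, ?_, hexp _ (le_trans ?_ hfloor), ?_⟩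
    · have h1 := Nat.div_mul_le_self n (2 * w)
      have h2 := Nat.mul_le_mul_right (2 * w) (min_le_left k₁ k₂)
      calc 2 * (min k₁ k₂ * w) = min k₁ k₂ * (2 * w) := by ring
        _ ≤ n := h2.trans h1
    · exact_mod_cast min_le_right _ _
    · rcases min_cases k₁ k₂ with ⟨h, -⟩ | ⟨h, -⟩ <;> rw [h]
      · refine (min_le_left _ _).trans ?_
        have h1 : 1 ≤ k₁ := (Nat.one_le_div_iff (by omega)).2 hnw
        have h2 : n < (k₁ + 1) * (2 * w) := by
          have := Nat.lt_div_mul_add (a := n) (b := 2 * w) (by omega)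
          rw [add_mul, one_mul]
          exact this
        have h3 : n ≤ 4 * (k₁ * w) := by nlinarith
        rw [← mul_div_assoc, le_div_iff₀ hn', one_mul]
        exact_mod_cast h3
      · refine (min_le_right _ _).trans ?_
        have hlog : Real.log r ≤ 2 * Real.log m := by
          rw [← Real.log_rpow (by linarith)]
          refine Real.log_le_log hr0 ?_
          norm_num
          nlinarith
        have hk : Real.log m / (2 * ε) ≤ k₂ := by
          simp only [k₂]
          push_cast
          exact (Nat.lt_floor_add_one _).le
        have hk' : Real.log r ≤ 4 * k₂ * ε := by
          rw [div_le_iff₀ (by positivity)] at hk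
          linarith
        rw [← mul_div_assoc, div_le_div_iff₀ (by positivity) hn']
        have := mul_le_mul_of_nonneg_left hk' (by positivity : (0 : ℝ) ≤ w * n)
        linarith

/-- **Lemma 14 (Lower Bound for the Grid Poset).** There is a universal constant `c > 0`
such that for the grid poset `X = {1,…,w} × {1,…,h}` (here `Fin w × Fin h` with the
product order) with `1 ≤ w ≤ h` and `h ≥ 3w`, any `R`-distance-based loss `ℓ`, any
`n ≥ 1`, `ε ∈ (0,1]` and `0 ≤ δ ≤ 0.01·ε·w/h`, every `(ε,δ)`-DP isotonic-regression
mechanism has, on some dataset, expected excess empirical risk at least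
`c · R · min{1, w·log(h/w)/(εn)}`. -/
theorem dp_isotonic_regression_grid_lower_bound :
    ∃ c : ℝ, 0 < c ∧
      ∀ w h : ℕ, 1 ≤ w → w ≤ h → 3 * w ≤ h →
        ∀ (ℓ : ℝ → ℝ → ℝ) (R : ℝ), IsDistanceBasedLoss ℓ R →
        ∀ n : ℕ, 1 ≤ n →
        ∀ ε δ : ℝ, ε ∈ Set.Ioc (0 : ℝ) 1 → 0 ≤ δ → δ ≤ 0.01 * ε * w / h →
        ∀ M : (Fin n → (Fin w × Fin h) × ℝ) → Measure (Fin w × Fin h → ℝ),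
          IsIsoRegAlg M →
          IsDP NeighborDS M ε δ →
          ∃ D : Fin n → (Fin w × Fin h) × ℝ, IsDataset D ∧
            c * R * min 1 ((w : ℝ) * Real.log ((h : ℝ) / w) / (ε * n)) ≤
              (∫ f, empRisk ℓ f D ∂(M D)) - optRisk ℓ D := by
  refine ⟨1 / 192, by norm_num, ?_⟩
  intro w h hw _ h3 ℓ R hℓ n hn ε δ ⟨hε, hε1⟩ hδ hδε M hM hDP
  obtain ⟨R', hR', hRR', hℓ'⟩ : ∃ R', 0 ≤ R' ∧ R ≤ R' ∧ IsDistanceBasedLoss ℓ R' := by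
    obtain ⟨g, hg, h0, hg0, hR, hgℓ⟩ := hℓ
    exact ⟨g (1 / 2), h0 _ (by norm_num), hR, g, hg, h0, hg0, le_rfl, hgℓ⟩
  have hw' : (0 : ℝ) < w := by exact_mod_cast hw
  have hn' : (0 : ℝ) < n := by exact_mod_cast hn
  have hh' : (3 : ℝ) * w ≤ h := by exact_mod_cast h3
  have hh0 : (0 : ℝ) < h := by linarith
  have hr : (3 : ℝ) ≤ h / w := (le_div_iff₀ hw').2 hh'
  have hδε' : δ / ε ≤ 0.01 * (w / h) := by
    rw [div_le_iff₀ hε]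
    refine hδε.trans_eq ?_
    ring
  set ρ := min 1 ((w : ℝ) * Real.log ((h : ℝ) / w) / (ε * n))
  have hρ0 : 0 ≤ ρ := le_min zero_le_one (by
    have := Real.log_nonneg (by linarith : (1 : ℝ) ≤ h / w)
    positivity)
  suffices ∃ D : Fin n → (Fin w × Fin h) × ℝ, IsDataset D ∧
      1 / 192 * R' * ρ ≤ (∫ f, empRisk ℓ f D ∂(M D)) - optRisk ℓ D by
    obtain ⟨D, hD, hle⟩ := this
    refine ⟨D, hD, le_trans ?_ hle⟩
    gcongr
  rcases hn.eq_or_lt with rfl | hn2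
  · have : Nonempty (Fin w × Fin h) := ⟨(⟨0, by omega⟩, ⟨0, by omega⟩)⟩
    have hwh : (w : ℝ) / h ≤ 1 := (div_le_one hh0).2 (by linarith)
    obtain ⟨D, hD, hle⟩ := exists_excess_risk_ge_of_single_sample hℓ' hR' hε hε1 hδ
      (by linarith) hM hDP
    refine ⟨D, hD, le_trans ?_ hle⟩
    have hρ1 : ρ ≤ 1 := min_le_left _ _
    nlinarith
  · set m := h / w
    have hm : 3 ≤ m := (Nat.le_div_iff_mul_le hw).2 h3
    have hm' : (3 : ℝ) ≤ m := by exact_mod_cast hm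
    have hmw : w * m ≤ h := Nat.mul_div_le h w
    have hmw' : (w : ℝ) * m ≤ h := by exact_mod_cast hmw
    have hrm : (h : ℝ) / w ≤ m + 1 := by
      rw [div_le_iff₀ hw']
      have := Nat.lt_div_mul_add (a := h) (b := w) hw
      have h2 : h ≤ (m + 1) * w := by rw [add_mul, one_mul]; exact this.le
      exact_mod_cast h2
    obtain ⟨W, k, hW, hWw, hkW, hexp, hρ⟩ :=
      exists_packing_parameters hw hm hn2 hε hε1 (by linarith : (0 : ℝ) < h / w) hrm
    obtain ⟨t, ht⟩ : ∃ t, m = t + 1 := ⟨m - 1, by omega⟩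
    have ht' : (m : ℝ) = t + 1 := by exact_mod_cast ht
    rw [ht] at hmw
    obtain ⟨pt, hpt, hmono⟩ := exists_incomparable_chains_grid hWw hmw
    have : NeZero W := ⟨by omega⟩
    have : NeZero t := ⟨by omega⟩
    obtain ⟨D, hD, hle⟩ := exists_excess_risk_ge_of_chains pt hpt hmono hkW hℓ' hR' hε hδ hM hDP
      (by linarith) (by
        have h1 : (m : ℝ) * (w / h) ≤ 1 := by
          rw [← mul_div_assoc, div_le_one hh0]
          linarith
        have h2 := mul_le_mul hexp hδε' (div_nonneg hδ hε.le) (by positivity)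
        linarith)
    refine ⟨D, hD, le_trans ?_ hle⟩
    have h1 := mul_le_mul_of_nonneg_left hρ hR'
    have h2 : 1 / (n : ℝ) * (k * R') * W / 48 = R' * (k * W / n) / 48 := by ring
    rw [h2]
    linarith
end
end

section
/- There is a universal constant C > 0 such that the following holds. Let w ≥ 1 and h ≥ 2 be integers and let X be the poset consisting of w pairwise-incomparable chains C_1, ..., C_w, where |C_1| = h and |C_2| = ... = |C_w| = 1 (elements of different chains are incomparable). Let ℓ : [0,1]×[0,1] → ℝ≥0 be an L-Lipschitz loss function, let n ≥ 1 and ε ∈ (0,1]. Then there exists a randomized algorithm M mapping each dataset D ∈ (X×[0,1])^n to a probability distribution over monotone functions f : X → [0,1], such that M is ε-differentially private and for every dataset D, the expected excess empirical risk E_{f∼M(D)}[L_ℓ(f;D)] − min_{g monotone} L_ℓ(g;D) is at most C · L · (w + log h) · (1 + log²(εn)) / (εn). -/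
open MeasureTheory

noncomputable section

/-- The poset consisting of `w` pairwise-incomparable chains: one chain of size `h`
(the `Fin h` component, with its usual order) together with `w - 1` singleton chains
(the `Fin (w-1)` component); elements of different chains are incomparable. -/
def DisjChains (w h : ℕ) : Type := Fin h ⊕ Fin (w - 1)

instance (w h : ℕ) : PartialOrder (DisjChains w h) where
  le a b := a = b ∨ ∃ i j : Fin h, a = Sum.inl i ∧ b = Sum.inl j ∧ i ≤ j
  le_refl a := Or.inl rfl
  le_trans := by
    rintro a b c (rfl | ⟨i, j, rfl, rfl, hij⟩) hbc
    · exact hbc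
    · rcases hbc with rfl | ⟨i', j', hi', rfl, hij'⟩
      · exact Or.inr ⟨i, j, rfl, rfl, hij⟩
      · obtain rfl : j = i' := Sum.inl.inj hi'
        exact Or.inr ⟨i, j', rfl, rfl, hij.trans hij'⟩
  le_antisymm := by
    rintro a b (rfl | ⟨i, j, rfl, rfl, hij⟩) hba
    · rfl
    · rcases hba with h | ⟨i', j', hi', hj', hij'⟩
      · exact h.symm
      · obtain rfl : j = i' := Sum.inl.inj hi'
        obtain rfl : i = j' := Sum.inl.inj hj'
        exact congrArg Sum.inl (le_antisymm hij hij')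

/-- The Gibbs weights `exp (-β s u) / ∑ v, exp (-β s v)` of the exponential mechanism. -/
def gibbs {ι : Type*} [Fintype ι] (β : ℝ) (s : ι → ℝ) (u : ι) : ℝ :=
  Real.exp (-(β * s u)) / ∑ v, Real.exp (-(β * s v))

section Gibbs

variable {ι : Type*} [Fintype ι]

lemma gibbs_nonneg (β : ℝ) (s : ι → ℝ) (u : ι) : 0 ≤ gibbs β s u := by
  unfold gibbs; positivity

lemma partition_pos [Nonempty ι] (β : ℝ) (s : ι → ℝ) : 0 < ∑ v, Real.exp (-(β * s v)) :=
  Finset.sum_pos (fun _ _ => Real.exp_pos _) Finset.univ_nonempty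

lemma sum_gibbs [Nonempty ι] (β : ℝ) (s : ι → ℝ) : ∑ u, gibbs β s u = 1 := by
  unfold gibbs
  rw [← Finset.sum_div, div_self (partition_pos β s).ne']

lemma gibbs_le_exp_mul [Nonempty ι] {β m K : ℝ} (hβ : 0 ≤ β) {s s' : ι → ℝ}
    (hlo : ∀ u, s u + m ≤ s' u) (hhi : ∀ u, s' u ≤ s u + (m + K)) (u : ι) :
    gibbs β s u ≤ Real.exp (β * K) * gibbs β s' u := by
  unfold gibbs
  rw [← mul_div_assoc, div_le_div_iff₀ (partition_pos β s) (partition_pos β s')]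
  have h1 : Real.exp (-(β * s u)) ≤ Real.exp (β * (m + K)) * Real.exp (-(β * s' u)) := by
    rw [← Real.exp_add]
    apply Real.exp_le_exp.2
    nlinarith [mul_le_mul_of_nonneg_left (hhi u) hβ]
  have h2 : ∑ v, Real.exp (-(β * s' v)) ≤ Real.exp (-(β * m)) * ∑ v, Real.exp (-(β * s v)) := by
    rw [Finset.mul_sum]
    refine Finset.sum_le_sum fun v _ => ?_
    rw [← Real.exp_add]
    apply Real.exp_le_exp.2
    nlinarith [mul_le_mul_of_nonneg_left (hlo v) hβ]
  calc Real.exp (-(β * s u)) * ∑ v, Real.exp (-(β * s' v))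
      ≤ (Real.exp (β * (m + K)) * Real.exp (-(β * s' u))) *
          (Real.exp (-(β * m)) * ∑ v, Real.exp (-(β * s v))) :=
        mul_le_mul h1 h2 (partition_pos β s').le (by positivity)
    _ = Real.exp (β * K) * Real.exp (-(β * s' u)) * ∑ v, Real.exp (-(β * s v)) := by
        have : Real.exp (β * K) = Real.exp (β * (m + K)) * Real.exp (-(β * m)) := by
          rw [← Real.exp_add]; congr 1; ring
        rw [this]; ring

lemma sum_gibbs_mul_le [Nonempty ι] {β : ℝ} (hβ : 0 < β) (s : ι → ℝ) (u₀ : ι) :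
    ∑ u, gibbs β s u * s u ≤ s u₀ + Real.log (Fintype.card ι) / β := by
  have hk : (0 : ℝ) < Fintype.card ι := by exact_mod_cast Fintype.card_pos
  set Z := ∑ v, Real.exp (-(β * s v)) with hZ
  have hZpos : 0 < Z := partition_pos β s
  have hterm : ∀ u, gibbs β s u * (β * s u + Real.log Z - Real.log (Fintype.card ι)) ≤
      1 / (Fintype.card ι : ℝ) - gibbs β s u := by
    intro u
    have hq : 0 < gibbs β s u := div_pos (Real.exp_pos _) hZpos
    have hlog : Real.log (1 / (gibbs β s u * Fintype.card ι)) =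
        β * s u + Real.log Z - Real.log (Fintype.card ι) := by
      rw [one_div, Real.log_inv, Real.log_mul hq.ne' hk.ne']
      unfold gibbs
      rw [← hZ, Real.log_div (Real.exp_pos _).ne' hZpos.ne', Real.log_exp]
      ring
    rw [← hlog]
    have := Real.log_le_sub_one_of_pos (x := 1 / (gibbs β s u * Fintype.card ι)) (by positivity)
    calc _ ≤ gibbs β s u * (1 / (gibbs β s u * Fintype.card ι) - 1) :=
          mul_le_mul_of_nonneg_left this hq.le
      _ = _ := by field_simp
  have hsum := Finset.sum_le_sum fun u (_ : u ∈ Finset.univ) => hterm u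
  have hleft : ∑ u, gibbs β s u * (β * s u + Real.log Z - Real.log (Fintype.card ι)) =
      β * (∑ u, gibbs β s u * s u) + (Real.log Z - Real.log (Fintype.card ι)) := by
    have : (Real.log Z - Real.log (Fintype.card ι)) =
        ∑ u, gibbs β s u * (Real.log Z - Real.log (Fintype.card ι)) := by
      rw [← Finset.sum_mul, sum_gibbs, one_mul]
    rw [this, Finset.mul_sum, ← Finset.sum_add_distrib]
    refine Finset.sum_congr rfl fun u _ => by ring
  have hright : ∑ u, (1 / (Fintype.card ι : ℝ) - gibbs β s u) = 0 := by
    rw [Finset.sum_sub_distrib, sum_gibbs, Finset.sum_const, Finset.card_univ, nsmul_eq_mul,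
      mul_one_div_cancel hk.ne', sub_self]
  have hZge : -(β * s u₀) ≤ Real.log Z := by
    rw [Real.le_log_iff_exp_le hZpos]
    exact Finset.single_le_sum (f := fun v => Real.exp (-(β * s v)))
      (fun _ _ => (Real.exp_pos _).le) (Finset.mem_univ u₀)
  rw [hleft, hright] at hsum
  rw [← mul_le_mul_iff_right₀ hβ, mul_add, mul_div_cancel₀ _ hβ.ne']
  linarith

end Gibbs

/-- Complete binary trees of depth `d` with inner nodes labelled by `ι`. -/
def CutTree.{u} (ι : Type u) : ℕ → Type u
  | 0 => PUnit
  | d + 1 => ι × CutTree ι d × CutTree ι d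

instance CutTree.instFintype (ι : Type*) [Fintype ι] : (d : ℕ) → Fintype (CutTree ι d)
  | 0 => inferInstanceAs (Fintype PUnit)
  | d + 1 =>
    haveI := CutTree.instFintype ι d
    inferInstanceAs (Fintype (ι × CutTree ι d × CutTree ι d))

/-- The tree with root label `u` and subtrees `a`, `b`. -/
def CutTree.node {ι : Type*} {d : ℕ} (u : ι) (a b : CutTree ι d) : CutTree ι (d + 1) :=
  (u, a, b)

lemma sum_cutTree_zero {ι : Type*} [Fintype ι] (φ : CutTree ι 0 → ℝ) :
    ∑ t, φ t = φ PUnit.unit :=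
  Fintype.sum_unique (ι := PUnit) φ

lemma sum_cutTree_succ {ι : Type*} [Fintype ι] {d : ℕ} (φ : CutTree ι (d + 1) → ℝ) :
    ∑ t, φ t = ∑ u : ι, ∑ a : CutTree ι d, ∑ b : CutTree ι d, φ (.node u a b) :=
  (Fintype.sum_prod_type (fun t : ι × CutTree ι d × CutTree ι d => φ t)).trans
    (Finset.sum_congr rfl fun u _ =>
      Fintype.sum_prod_type (fun t : CutTree ι d × CutTree ι d => φ (.node u t.1 t.2)))

section Mechanism

variable {X : Type*} [Fintype X] [PartialOrder X]

noncomputable instance UpperSet.instFintypeOfFintype : Fintype (UpperSet X) :=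
  haveI : Finite (UpperSet X) :=
    Finite.of_injective (fun U : UpperSet X => (U : Set X)) SetLike.coe_injective
  Fintype.ofFinite _

open Classical in
/-- The cost family `c` restricted to the points of `S`. -/
def maskCost (S : Set X) (c : X → ℝ → ℝ) : X → ℝ → ℝ :=
  fun x v => if x ∈ S then c x v else 0

/-- The function encoded by a tree of cuts: each upper set splits the value interval
`[lo, lo + τ]` in half. -/
def cutFun : (d : ℕ) → ℝ → ℝ → CutTree (UpperSet X) d → X → ℝ
  | 0, lo, _, _, _ => lo
  | d + 1, lo, τ, (U, a, b), x =>
    open Classical in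
    if x ∈ (U : Set X) then cutFun d (lo + τ / 2) (τ / 2) b x else cutFun d lo (τ / 2) a x

/-- The least total cost among the functions encoded by trees of depth `d`. -/
def cutOpt : ℕ → (X → ℝ → ℝ) → ℝ → ℝ → ℝ
  | 0, c, lo, _ => ∑ x, c x lo
  | d + 1, c, lo, τ => ⨅ U : UpperSet X,
    (cutOpt d (maskCost (U : Set X)ᶜ c) lo (τ / 2) +
      cutOpt d (maskCost (U : Set X) c) (lo + τ / 2) (τ / 2))

/-- The score of splitting along `U`. -/
def cutScore (d : ℕ) (c : X → ℝ → ℝ) (lo τ : ℝ) (U : UpperSet X) : ℝ :=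
  cutOpt d (maskCost (U : Set X)ᶜ c) lo (τ / 2) +
    cutOpt d (maskCost (U : Set X) c) (lo + τ / 2) (τ / 2)

/-- The output probabilities of the recursive exponential mechanism with privacy budget `η` per
level. -/
def cutProb (L η : ℝ) : (d : ℕ) → (X → ℝ → ℝ) → ℝ → ℝ → CutTree (UpperSet X) d → ℝ
  | 0, _, _, _, _ => 1
  | d + 1, c, lo, τ, (U, a, b) =>
    gibbs (η / (L * τ)) (cutScore d c lo τ) U *
      (cutProb L η d (maskCost (U : Set X)ᶜ c) lo (τ / 2) a *
        cutProb L η d (maskCost (U : Set X) c) (lo + τ / 2) (τ / 2) b)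

omit [Fintype X] in
lemma cutFun_node (d : ℕ) (lo τ : ℝ) (U : UpperSet X) (a b : CutTree (UpperSet X) d) (x : X) :
    cutFun (d + 1) lo τ (.node U a b) x =
      open Classical in
      if x ∈ (U : Set X) then cutFun d (lo + τ / 2) (τ / 2) b x else cutFun d lo (τ / 2) a x :=
  rfl

lemma cutProb_node (L η : ℝ) (d : ℕ) (c : X → ℝ → ℝ) (lo τ : ℝ) (U : UpperSet X)
    (a b : CutTree (UpperSet X) d) :
    cutProb L η (d + 1) c lo τ (.node U a b) =
      gibbs (η / (L * τ)) (cutScore d c lo τ) U *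
        (cutProb L η d (maskCost (U : Set X)ᶜ c) lo (τ / 2) a *
          cutProb L η d (maskCost (U : Set X) c) (lo + τ / 2) (τ / 2) b) :=
  rfl

omit [Fintype X] in
lemma cutFun_mem (d : ℕ) : ∀ (lo τ : ℝ), 0 ≤ τ → ∀ (t : CutTree (UpperSet X) d) (x : X),
    cutFun d lo τ t x ∈ Set.Icc lo (lo + τ) := by
  induction d with
  | zero => intro lo τ hτ t x; simp [cutFun, hτ]
  | succ d ih =>
    rintro lo τ hτ ⟨U, a, b⟩ x
    have ha := ih lo (τ / 2) (by linarith) a x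
    have hb := ih (lo + τ / 2) (τ / 2) (by linarith) b x
    simp only [cutFun, Set.mem_Icc] at *
    split_ifs <;> constructor <;> linarith

omit [Fintype X] in
lemma cutFun_monotone (d : ℕ) : ∀ (lo τ : ℝ), 0 ≤ τ → ∀ (t : CutTree (UpperSet X) d),
    Monotone (cutFun d lo τ t) := by
  induction d with
  | zero => intro lo τ hτ t x y _; simp [cutFun]
  | succ d ih =>
    rintro lo τ hτ ⟨U, a, b⟩ x y hxy
    have ha := ih lo (τ / 2) (by linarith) a hxy
    have hb := ih (lo + τ / 2) (τ / 2) (by linarith) b hxy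
    have ha' := (cutFun_mem d lo (τ / 2) (by linarith) a x).2
    have hb' := (cutFun_mem d (lo + τ / 2) (τ / 2) (by linarith) b y).1
    have hU : x ∈ (U : Set X) → y ∈ (U : Set X) := fun h => U.upper hxy h
    simp only [cutFun]
    split_ifs with h1 h2 h2
    · exact hb
    · exact absurd (hU h1) h2
    · linarith
    · exact ha

lemma cutProb_nonneg (L η : ℝ) (d : ℕ) : ∀ (c : X → ℝ → ℝ) (lo τ : ℝ)
    (t : CutTree (UpperSet X) d), 0 ≤ cutProb L η d c lo τ t := by
  induction d with
  | zero => intros; simp [cutProb]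
  | succ d ih =>
    rintro c lo τ ⟨U, a, b⟩
    exact mul_nonneg (gibbs_nonneg _ _ _) (mul_nonneg (ih _ _ _ _) (ih _ _ _ _))

lemma sum_cutProb (L η : ℝ) (d : ℕ) : ∀ (c : X → ℝ → ℝ) (lo τ : ℝ),
    ∑ t, cutProb L η d c lo τ t = 1 := by
  induction d with
  | zero =>
    intro c lo τ
    rw [sum_cutTree_zero]; rfl
  | succ d ih =>
    intro c lo τ
    rw [sum_cutTree_succ]
    simp only [cutProb_node, ← Finset.mul_sum, ih, mul_one, sum_gibbs]

lemma cutOpt_succ_le (d : ℕ) (c : X → ℝ → ℝ) (lo τ : ℝ) (U : UpperSet X) :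
    cutOpt (d + 1) c lo τ ≤ cutScore d c lo τ U :=
  ciInf_le (Set.finite_range (cutScore d c lo τ)).bddBelow U

lemma exists_cutScore_eq (d : ℕ) (c : X → ℝ → ℝ) (lo τ : ℝ) :
    ∃ U, cutScore d c lo τ U = cutOpt (d + 1) c lo τ :=
  exists_eq_ciInf_of_finite (f := cutScore d c lo τ)

omit [PartialOrder X] in
lemma sum_maskCost (c : X → ℝ → ℝ) (S : Set X) (f g k : X → ℝ)
    (hf : ∀ x ∈ S, f x = k x) (hg : ∀ x ∉ S, g x = k x) :
    ∑ x, maskCost Sᶜ c x (g x) + ∑ x, maskCost S c x (f x) = ∑ x, c x (k x) := by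
  rw [← Finset.sum_add_distrib]
  refine Finset.sum_congr rfl fun x _ => ?_
  by_cases hx : x ∈ S
  · simp [maskCost, hx, hf x hx]
  · simp [maskCost, hx, hg x hx]

lemma expected_cost_le {L η : ℝ} (hL : 0 < L) (hη : 0 < η) (d : ℕ) :
    ∀ (c : X → ℝ → ℝ) (lo τ : ℝ), 0 < τ →
      ∑ t, cutProb L η d c lo τ t * ∑ x, c x (cutFun d lo τ t x) ≤
        cutOpt d c lo τ + d * (L * τ * Real.log (Fintype.card (UpperSet X)) / η) := by
  induction d with
  | zero =>
    intro c lo τ _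
    rw [sum_cutTree_zero]; simp [cutProb, cutFun, cutOpt]
  | succ d ih =>
    intro c lo τ hτ
    obtain ⟨U₀, hU₀⟩ := exists_cutScore_eq d c lo τ
    have hg := sum_gibbs_mul_le (β := η / (L * τ)) (by positivity) (cutScore d c lo τ) U₀
    set K := Real.log (Fintype.card (UpperSet X))
    have hnode : ∀ U : UpperSet X, ∑ a : CutTree (UpperSet X) d, ∑ b : CutTree (UpperSet X) d,
        cutProb L η (d + 1) c lo τ (.node U a b) *
          ∑ x, c x (cutFun (d + 1) lo τ (.node U a b) x) ≤
        gibbs (η / (L * τ)) (cutScore d c lo τ) U *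
          (cutScore d c lo τ U + d * (L * τ * K / η)) := by
      intro U
      have hA := ih (maskCost (U : Set X)ᶜ c) lo (τ / 2) (by linarith)
      have hB := ih (maskCost (U : Set X) c) (lo + τ / 2) (τ / 2) (by linarith)
      have hpA := sum_cutProb L η d (maskCost (U : Set X)ᶜ c) lo (τ / 2)
      have hpB := sum_cutProb L η d (maskCost (U : Set X) c) (lo + τ / 2) (τ / 2)
      set q := gibbs (η / (L * τ)) (cutScore d c lo τ) U
      set P := cutProb L η d (maskCost (U : Set X)ᶜ c) lo (τ / 2)
      set Q := cutProb L η d (maskCost (U : Set X) c) (lo + τ / 2) (τ / 2)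
      set fA := fun a => ∑ x, maskCost (U : Set X)ᶜ c x (cutFun d lo (τ / 2) a x)
      set fB := fun b => ∑ x, maskCost (U : Set X) c x (cutFun d (lo + τ / 2) (τ / 2) b x)
      have hterm : ∀ a b, cutProb L η (d + 1) c lo τ (.node U a b) *
          ∑ x, c x (cutFun (d + 1) lo τ (.node U a b) x) =
          q * ((P a * fA a) * Q b + P a * (Q b * fB b)) := by
        intro a b
        have : ∑ x, c x (cutFun (d + 1) lo τ (.node U a b) x) = fA a + fB b := by
          refine (sum_maskCost c U _ _ _ ?_ ?_).symm
          · intro x hx; rw [cutFun_node, if_pos hx]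
          · intro x hx; rw [cutFun_node, if_neg hx]
        rw [this, cutProb_node]
        ring
      simp only [hterm, ← Finset.mul_sum, ← Finset.sum_mul, Finset.sum_add_distrib, hpA, hpB]
      refine mul_le_mul_of_nonneg_left ?_ (gibbs_nonneg _ _ _)
      have : cutScore d c lo τ U = cutOpt d (maskCost (U : Set X)ᶜ c) lo (τ / 2) +
        cutOpt d (maskCost (U : Set X) c) (lo + τ / 2) (τ / 2) := rfl
      rw [this]
      have h2 : (d : ℝ) * (L * τ * K / η) = d * (L * (τ / 2) * K / η) +
          d * (L * (τ / 2) * K / η) := by ring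
      linarith
    rw [sum_cutTree_succ]
    refine (Finset.sum_le_sum fun U _ => hnode U).trans ?_
    simp only [mul_add, Finset.sum_add_distrib]
    rw [← Finset.sum_mul, sum_gibbs, one_mul]
    have h3 : K / (η / (L * τ)) = L * τ * K / η := by field_simp
    rw [h3, hU₀] at hg
    push_cast
    linarith

lemma cutOpt_le_cost (d : ℕ) : ∀ (c : X → ℝ → ℝ) (W : X → ℝ) (lo τ : ℝ), 0 ≤ lo → 0 ≤ τ →
    lo + τ ≤ 1 → (∀ x, 0 ≤ W x) →
    (∀ x, ∀ v ∈ Set.Icc (0 : ℝ) 1, ∀ v' ∈ Set.Icc (0 : ℝ) 1,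
      c x v ≤ c x v' + W x * |v - v'|) →
    ∀ g : X → ℝ, Monotone g → (∀ x, g x ∈ Set.Icc lo (lo + τ)) →
      cutOpt d c lo τ ≤ ∑ x, c x (g x) + τ / 2 ^ d * ∑ x, W x := by
  induction d with
  | zero =>
    intro c W lo τ hlo hτ h1 hW hc g _ hg
    simp only [cutOpt, pow_zero, div_one]
    rw [Finset.mul_sum, ← Finset.sum_add_distrib]
    refine Finset.sum_le_sum fun x _ => ?_
    obtain ⟨ha, hb⟩ := hg x
    refine (hc x lo ⟨hlo, by linarith⟩ (g x) ⟨by linarith, by linarith⟩).trans ?_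
    have : |lo - g x| ≤ τ := by rw [abs_le]; constructor <;> linarith
    nlinarith [mul_le_mul_of_nonneg_left this (hW x)]
  | succ d ih =>
    intro c W lo τ hlo hτ h1 hW hc g hmono hg
    let U : UpperSet X := ⟨{x | lo + τ / 2 ≤ g x}, fun x y hxy hx => le_trans hx (hmono hxy)⟩
    have hmask : ∀ S : Set X, ∀ x, ∀ v ∈ Set.Icc (0 : ℝ) 1, ∀ v' ∈ Set.Icc (0 : ℝ) 1,
        maskCost S c x v ≤ maskCost S c x v' + maskCost S (fun x _ => W x) x 0 * |v - v'| := by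
      intro S x v hv v' hv'
      by_cases hx : x ∈ S
      · simpa [maskCost, hx] using hc x v hv v' hv'
      · simp [maskCost, hx]
    have hW' : ∀ S : Set X, ∀ x, 0 ≤ maskCost S (fun x _ => W x) x 0 := by
      intro S x
      unfold maskCost
      split_ifs
      exacts [hW x, le_rfl]
    have hA := ih (maskCost (U : Set X)ᶜ c) (fun x => maskCost (U : Set X)ᶜ (fun x _ => W x) x 0)
      lo (τ / 2) hlo (by linarith) (by linarith) (hW' _) (hmask _)
      (fun x => min (g x) (lo + τ / 2)) (hmono.min monotone_const)
      (fun x => ⟨le_min (hg x).1 (by linarith), min_le_right _ _⟩)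
    have hB := ih (maskCost (U : Set X) c) (fun x => maskCost (U : Set X) (fun x _ => W x) x 0)
      (lo + τ / 2) (τ / 2) (by linarith) (by linarith) (by linarith) (hW' _) (hmask _)
      (fun x => max (g x) (lo + τ / 2)) (hmono.max monotone_const)
      (fun x => ⟨le_max_right _ _, max_le (by linarith [(hg x).2]) (by linarith)⟩)
    have hsplit := sum_maskCost c (U : Set X) (fun x => max (g x) (lo + τ / 2))
      (fun x => min (g x) (lo + τ / 2)) g (fun x hx => max_eq_left hx)
      (fun x hx => min_eq_left (not_le.1 hx).le)
    have hWsum := sum_maskCost (fun x _ => W x) (U : Set X) 0 0 0 (fun _ _ => rfl) fun _ _ => rfl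
    simp only [Pi.zero_apply] at hWsum
    have hτd : τ / 2 / 2 ^ d = τ / 2 ^ (d + 1) := by rw [pow_succ]; field_simp
    refine (cutOpt_succ_le d c lo τ U).trans ?_
    unfold cutScore
    rw [hτd] at hA hB
    rw [← hsplit, ← hWsum, mul_add]
    linarith

omit [Fintype X] [PartialOrder X] in
lemma maskCost_congr {x₀ : X} {c c' : X → ℝ → ℝ} (h : ∀ x, x ≠ x₀ → c x = c' x)
    {S : Set X} (hx₀ : x₀ ∉ S) : maskCost S c = maskCost S c' := by
  funext x v
  by_cases hx : x ∈ S
  · have : x ≠ x₀ := fun he => hx₀ (he ▸ hx)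
    simp [maskCost, hx, h x this]
  · simp [maskCost, hx]

omit [Fintype X] [PartialOrder X] in
lemma maskCost_congr_off {x₀ : X} {c c' : X → ℝ → ℝ} (h : ∀ x, x ≠ x₀ → c x = c' x)
    (S : Set X) : ∀ x, x ≠ x₀ → maskCost S c x = maskCost S c' x := by
  intro x hx
  funext v
  simp [maskCost, h x hx]

lemma cutOpt_add_le {x₀ : X} {m : ℝ} (d : ℕ) : ∀ (c c' : X → ℝ → ℝ) (lo τ : ℝ), 0 ≤ τ →
    (∀ x, x ≠ x₀ → c x = c' x) → (∀ v ∈ Set.Icc lo (lo + τ), c x₀ v + m ≤ c' x₀ v) →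
    cutOpt d c lo τ + m ≤ cutOpt d c' lo τ ∧
      ∀ U, cutScore d c lo τ U + m ≤ cutScore d c' lo τ U := by
  have key : ∀ d : ℕ, (∀ (c c' : X → ℝ → ℝ) (lo τ : ℝ), 0 ≤ τ →
      (∀ x, x ≠ x₀ → c x = c' x) → (∀ v ∈ Set.Icc lo (lo + τ), c x₀ v + m ≤ c' x₀ v) →
      cutOpt d c lo τ + m ≤ cutOpt d c' lo τ) → ∀ (c c' : X → ℝ → ℝ) (lo τ : ℝ), 0 ≤ τ →
      (∀ x, x ≠ x₀ → c x = c' x) → (∀ v ∈ Set.Icc lo (lo + τ), c x₀ v + m ≤ c' x₀ v) →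
      ∀ U, cutScore d c lo τ U + m ≤ cutScore d c' lo τ U := by
    intro d ih c c' lo τ hτ hne h₀ U
    unfold cutScore
    by_cases hx : x₀ ∈ (U : Set X)
    · rw [maskCost_congr hne (S := (U : Set X)ᶜ) (by simpa using hx)]
      have := ih (maskCost (U : Set X) c) (maskCost (U : Set X) c') (lo + τ / 2) (τ / 2)
        (by linarith) (maskCost_congr_off hne _) (fun v hv => by
          simpa [maskCost, hx] using h₀ v ⟨by linarith [hv.1], by linarith [hv.2]⟩)
      linarith
    · rw [maskCost_congr hne hx]
      have := ih (maskCost (U : Set X)ᶜ c) (maskCost (U : Set X)ᶜ c') lo (τ / 2)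
        (by linarith) (maskCost_congr_off hne _) (fun v hv => by
          simpa [maskCost, hx] using h₀ v ⟨by linarith [hv.1], by linarith [hv.2]⟩)
      linarith
  have main : ∀ (c c' : X → ℝ → ℝ) (lo τ : ℝ), 0 ≤ τ →
      (∀ x, x ≠ x₀ → c x = c' x) → (∀ v ∈ Set.Icc lo (lo + τ), c x₀ v + m ≤ c' x₀ v) →
      cutOpt d c lo τ + m ≤ cutOpt d c' lo τ := by
    induction d with
    | zero =>
      intro c c' lo τ hτ hne h₀
      classical
      simp only [cutOpt]
      rw [← Finset.add_sum_erase _ _ (Finset.mem_univ x₀),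
        ← Finset.add_sum_erase _ (fun x => c' x lo) (Finset.mem_univ x₀)]
      have : ∑ x ∈ Finset.univ.erase x₀, c x lo = ∑ x ∈ Finset.univ.erase x₀, c' x lo :=
        Finset.sum_congr rfl fun x hx => by rw [hne x (Finset.ne_of_mem_erase hx)]
      linarith [h₀ lo ⟨le_rfl, by linarith⟩]
    | succ d ih =>
      intro c c' lo τ hτ hne h₀
      obtain ⟨U, hU⟩ := exists_cutScore_eq d c' lo τ
      rw [← hU]
      linarith [key d ih c c' lo τ hτ hne h₀ U, cutOpt_succ_le d c lo τ U]
  exact fun c c' lo τ hτ hne h₀ => ⟨main c c' lo τ hτ hne h₀, key d main c c' lo τ hτ hne h₀⟩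

/-- Two cost families that differ only at `x₀`, by an `L`-Lipschitz function on `[0,1]`. -/
def CostNeighbor (L : ℝ) (x₀ : X) (c c' : X → ℝ → ℝ) : Prop :=
  (∀ x, x ≠ x₀ → c x = c' x) ∧ ∀ v ∈ Set.Icc (0 : ℝ) 1, ∀ v' ∈ Set.Icc (0 : ℝ) 1,
    |(c' x₀ v - c x₀ v) - (c' x₀ v' - c x₀ v')| ≤ L * |v - v'|

omit [Fintype X] [PartialOrder X] in
lemma CostNeighbor.symm {L : ℝ} {x₀ : X} {c c' : X → ℝ → ℝ} (h : CostNeighbor L x₀ c c') :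
    CostNeighbor L x₀ c' c := by
  refine ⟨fun x hx => (h.1 x hx).symm, fun v hv v' hv' => ?_⟩
  rw [← abs_neg]
  convert h.2 v hv v' hv' using 2
  ring

omit [Fintype X] [PartialOrder X] in
lemma CostNeighbor.mask {L : ℝ} {x₀ : X} {c c' : X → ℝ → ℝ} (h : CostNeighbor L x₀ c c')
    {S : Set X} (hx : x₀ ∈ S) : CostNeighbor L x₀ (maskCost S c) (maskCost S c') :=
  ⟨maskCost_congr_off h.1 S, by simpa only [maskCost, if_pos hx] using h.2⟩

lemma cutProb_le {L η : ℝ} (hL : 0 < L) (hη : 0 < η) {x₀ : X} (d : ℕ) :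
    ∀ (c c' : X → ℝ → ℝ) (lo τ : ℝ), 0 ≤ lo → 0 < τ → lo + τ ≤ 1 → CostNeighbor L x₀ c c' →
    ∀ t, cutProb L η d c lo τ t ≤ Real.exp (d * η) * cutProb L η d c' lo τ t := by
  induction d with
  | zero => intros; simp [cutProb]
  | succ d ih =>
    rintro c c' lo τ hlo hτ h1 hcc ⟨U, a, b⟩
    have hmid : lo + τ / 2 ∈ Set.Icc (0 : ℝ) 1 := ⟨by linarith, by linarith⟩
    have hΔ : ∀ v ∈ Set.Icc lo (lo + τ),
        |(c' x₀ v - c x₀ v) - (c' x₀ (lo + τ / 2) - c x₀ (lo + τ / 2))| ≤ L * (τ / 2) := by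
      intro v hv
      refine (hcc.2 v ⟨by linarith [hv.1], by linarith [hv.2]⟩ _ hmid).trans ?_
      refine mul_le_mul_of_nonneg_left ?_ hL.le
      rw [abs_le]; constructor <;> linarith [hv.1, hv.2]
    set m := c' x₀ (lo + τ / 2) - c x₀ (lo + τ / 2) with hm
    have hlow := (cutOpt_add_le (m := m - L * (τ / 2)) d c c' lo τ hτ.le hcc.1
      (fun v hv => by linarith [(abs_le.1 (hΔ v hv)).1])).2
    have hhigh := (cutOpt_add_le (m := -(m + L * (τ / 2))) d c' c lo τ hτ.le hcc.symm.1
      (fun v hv => by linarith [(abs_le.1 (hΔ v hv)).2])).2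
    have hq := gibbs_le_exp_mul (β := η / (L * τ)) (K := L * τ) (by positivity) hlow
      (fun u => by linarith [hhigh u]) U
    rw [div_mul_cancel₀ _ (by positivity)] at hq
    have hsub : cutProb L η d (maskCost (U : Set X)ᶜ c) lo (τ / 2) a *
        cutProb L η d (maskCost (U : Set X) c) (lo + τ / 2) (τ / 2) b ≤ Real.exp (d * η) *
        (cutProb L η d (maskCost (U : Set X)ᶜ c') lo (τ / 2) a *
        cutProb L η d (maskCost (U : Set X) c') (lo + τ / 2) (τ / 2) b) := by
      by_cases hx : x₀ ∈ (U : Set X)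
      · rw [maskCost_congr hcc.1 (S := (U : Set X)ᶜ) (by simpa using hx), mul_left_comm]
        exact mul_le_mul_of_nonneg_left (ih _ _ _ _ (by linarith) (by linarith) (by linarith)
          (hcc.mask hx) b) (cutProb_nonneg _ _ _ _ _ _ _)
      · rw [maskCost_congr hcc.1 hx, ← mul_assoc]
        exact mul_le_mul_of_nonneg_right (ih _ _ _ _ (by linarith) (by linarith) (by linarith)
          (hcc.mask hx) a) (cutProb_nonneg _ _ _ _ _ _ _)
    have hexp : Real.exp ((d + 1 : ℕ) * η) = Real.exp η * Real.exp (d * η) := by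
      rw [← Real.exp_add]; congr 1; push_cast; ring
    simp only [cutProb]
    rw [hexp]
    refine (mul_le_mul hq hsub (mul_nonneg (cutProb_nonneg _ _ _ _ _ _ _)
      (cutProb_nonneg _ _ _ _ _ _ _)) (mul_nonneg (Real.exp_pos _).le
      (gibbs_nonneg _ _ _))).trans_eq (by ring)

end Mechanism

section FiniteMixture

variable {T Ω : Type*} [Fintype T] [MeasurableSpace Ω] [MeasurableSingletonClass Ω]

/-- The pushforward under `F` of the distribution with weights `p`. -/
def finiteMixture (p : T → ℝ) (F : T → Ω) : Measure Ω :=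
  ∑ t, ENNReal.ofReal (p t) • Measure.dirac (F t)

lemma finiteMixture_apply (p : T → ℝ) (F : T → Ω) (S : Set Ω) :
    finiteMixture p F S = ∑ t, ENNReal.ofReal (p t) * S.indicator 1 (F t) := by
  simp [finiteMixture, Measure.finsetSum_apply]

lemma finiteMixture_eq_one {p : T → ℝ} (hp : ∀ t, 0 ≤ p t) (hsum : ∑ t, p t = 1) {F : T → Ω}
    {S : Set Ω} (hS : ∀ t, F t ∈ S) : finiteMixture p F S = 1 := by
  rw [finiteMixture_apply]
  simp only [Set.indicator_of_mem (hS _), Pi.one_apply, mul_one]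
  rw [← ENNReal.ofReal_sum_of_nonneg fun t _ => hp t, hsum, ENNReal.ofReal_one]

lemma finiteMixture_le {p p' : T → ℝ} {r : ℝ} (hr : 0 ≤ r) (h : ∀ t, p t ≤ r * p' t)
    (F : T → Ω) (S : Set Ω) :
    finiteMixture p F S ≤ ENNReal.ofReal r * finiteMixture p' F S := by
  rw [finiteMixture_apply, finiteMixture_apply, Finset.mul_sum]
  refine Finset.sum_le_sum fun t _ => ?_
  rw [← mul_assoc, ← ENNReal.ofReal_mul hr]
  gcongr
  exact h t

lemma integral_finiteMixture {p : T → ℝ} (hp : ∀ t, 0 ≤ p t) (F : T → Ω) (φ : Ω → ℝ) :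
    ∫ ω, φ ω ∂(finiteMixture p F) = ∑ t, p t * φ (F t) := by
  unfold finiteMixture
  rw [integral_finsetSum_measure fun t _ =>
    (integrable_dirac (by simp)).smul_measure ENNReal.ofReal_ne_top]
  refine Finset.sum_congr rfl fun t _ => ?_
  rw [integral_smul_measure, integral_dirac, ENNReal.toReal_ofReal (hp t), smul_eq_mul]

end FiniteMixture

section Dataset

variable {X : Type*} [Fintype X] [PartialOrder X] {n : ℕ}

open Classical in
/-- The total loss at the point `x` of predicting `v` there. -/
def dataCost (ℓ : ℝ → ℝ → ℝ) (I : Finset (Fin n)) (D : Fin n → X × ℝ) (x : X) (v : ℝ) : ℝ :=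
  ∑ i ∈ I, if (D i).1 = x then ℓ v (D i).2 else 0

omit [PartialOrder X] in
lemma sum_dataCost (ℓ : ℝ → ℝ → ℝ) (D : Fin n → X × ℝ) (f : X → ℝ) :
    ∑ x, dataCost ℓ Finset.univ D x (f x) = ∑ i, ℓ (f (D i).1) (D i).2 := by
  classical
  unfold dataCost
  rw [Finset.sum_comm]
  refine Finset.sum_congr rfl fun i _ => ?_
  simp

omit [Fintype X] [PartialOrder X] in
lemma dataCost_neighbor {ℓ : ℝ → ℝ → ℝ} {L : ℝ} (hℓ : IsLipschitzLoss ℓ L)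
    {D : Fin n → X × ℝ} (hD : IsDataset D) (i : Fin n) :
    CostNeighbor L (D i).1 (dataCost ℓ (Finset.univ.erase i) D)
      (dataCost ℓ Finset.univ D) := by
  have h : ∀ x v, dataCost ℓ Finset.univ D x v =
      (open Classical in if (D i).1 = x then ℓ v (D i).2 else 0) +
        dataCost ℓ (Finset.univ.erase i) D x v :=
    fun x v => (Finset.add_sum_erase _ _ (Finset.mem_univ i)).symm
  refine ⟨fun x hx => ?_, fun v hv v' hv' => ?_⟩
  · funext v
    rw [h, if_neg hx.symm, zero_add]
  · rw [h, h, if_pos rfl, if_pos rfl, add_sub_cancel_right, add_sub_cancel_right]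
    exact hℓ.2 v v' _ hv hv' (hD i)

omit [Fintype X] [PartialOrder X] in
lemma dataCost_erase_congr (ℓ : ℝ → ℝ → ℝ) {D D' : Fin n → X × ℝ} {i : Fin n}
    (h : ∀ j, j ≠ i → D j = D' j) :
    dataCost ℓ (Finset.univ.erase i) D = dataCost ℓ (Finset.univ.erase i) D' := by
  funext x v
  refine Finset.sum_congr rfl fun j hj => ?_
  rw [h j (Finset.ne_of_mem_erase hj)]

omit [Fintype X] [PartialOrder X] in
lemma dataCost_lipschitz {ℓ : ℝ → ℝ → ℝ} {L : ℝ} (hℓ : IsLipschitzLoss ℓ L)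
    {D : Fin n → X × ℝ} (hD : IsDataset D) (x : X) :
    ∀ v ∈ Set.Icc (0 : ℝ) 1, ∀ v' ∈ Set.Icc (0 : ℝ) 1,
      dataCost ℓ Finset.univ D x v ≤ dataCost ℓ Finset.univ D x v' +
        dataCost (fun _ _ => L) Finset.univ D x 0 * |v - v'| := by
  intro v hv v' hv'
  unfold dataCost
  rw [Finset.sum_mul, ← Finset.sum_add_distrib]
  refine Finset.sum_le_sum fun i _ => ?_
  split_ifs
  · linarith [(abs_le.1 (hℓ.2 v v' _ hv hv' (hD i))).2]
  · simp

/-- Excess risk of the recursive exponential mechanism on an arbitrary finite poset. -/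
theorem exists_dp_isoRegAlg {ℓ : ℝ → ℝ → ℝ} {L : ℝ} (hL : 0 < L) (hℓ : IsLipschitzLoss ℓ L)
    (hn : 1 ≤ n) {ε : ℝ} (hε : 0 < ε) {d : ℕ} (hd : 1 ≤ d) :
    ∃ M : (Fin n → X × ℝ) → Measure (X → ℝ),
      IsIsoRegAlg M ∧ IsDP NeighborDS M ε 0 ∧
      ∀ D : Fin n → X × ℝ, IsDataset D → (∫ f, empRisk ℓ f D ∂(M D)) - optRisk ℓ D ≤
        2 * d ^ 2 * L * Real.log (Fintype.card (UpperSet X)) / (ε * n) + L / 2 ^ d := by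
  have hd0 : (0 : ℝ) < d := by exact_mod_cast hd
  have hn0 : (0 : ℝ) < n := by exact_mod_cast hn
  set η := ε / (2 * d) with hη_def
  have hη : 0 < η := by positivity
  let p : (Fin n → X × ℝ) → CutTree (UpperSet X) d → ℝ :=
    fun D => cutProb L η d (dataCost ℓ Finset.univ D) 0 1
  have hp : ∀ D t, 0 ≤ p D t := fun D t => cutProb_nonneg _ _ _ _ _ _ _
  have hsum : ∀ D, ∑ t, p D t = 1 := fun D => sum_cutProb _ _ _ _ _ _
  refine ⟨fun D => finiteMixture (p D) (cutFun d 0 1), fun D _ => ⟨⟨?_⟩, ?_⟩, ?_, ?_⟩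
  · exact finiteMixture_eq_one (hp D) (hsum D) fun _ => Set.mem_univ _
  · refine finiteMixture_eq_one (hp D) (hsum D) fun t =>
      ⟨cutFun_monotone d 0 1 zero_le_one t, fun x => ?_⟩
    simpa using cutFun_mem d 0 1 zero_le_one t x
  · rintro D D' ⟨hD, hD', i, hi⟩ S _
    rw [ENNReal.ofReal_zero, add_zero]
    refine finiteMixture_le (Real.exp_pos _).le (fun t => ?_) _ _
    have h1 := cutProb_le hL hη d _ _ 0 1 le_rfl one_pos (by norm_num)
      (dataCost_neighbor hℓ hD i).symm t
    have h2 := cutProb_le hL hη d _ _ 0 1 le_rfl one_pos (by norm_num)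
      (dataCost_neighbor hℓ hD' i) t
    rw [dataCost_erase_congr ℓ hi] at h1
    have hexp : Real.exp ε = Real.exp (d * η) * Real.exp (d * η) := by
      rw [← Real.exp_add]; congr 1; rw [hη_def]; field_simp; norm_num
    rw [hexp, mul_assoc]
    exact h1.trans (mul_le_mul_of_nonneg_left h2 (Real.exp_pos _).le)
  · intro D hD
    rw [integral_finiteMixture (hp D), sub_le_iff_le_add, ← sub_le_iff_le_add']
    have : Nonempty {g : X → ℝ // IsMonotone01 g} :=
      ⟨⟨fun _ => 0, monotone_const, fun _ => ⟨le_rfl, zero_le_one⟩⟩⟩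
    refine le_ciInf fun ⟨g, hg⟩ => ?_
    have hE := expected_cost_le hL hη d (dataCost ℓ Finset.univ D) 0 1 one_pos
    have hW : ∀ x, 0 ≤ dataCost (fun _ _ => L) Finset.univ D x 0 := fun x =>
      Finset.sum_nonneg fun i _ => by split_ifs <;> linarith
    have hO := cutOpt_le_cost d (dataCost ℓ Finset.univ D) _ 0 1 le_rfl zero_le_one (by norm_num)
      hW (dataCost_lipschitz hℓ hD) g hg.1 (by simpa using hg.2)
    have hWsum := sum_dataCost (fun _ _ => L) D (fun _ => 0)
    simp only [Finset.sum_const, Finset.card_univ, Fintype.card_fin, nsmul_eq_mul] at hWsum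
    rw [hWsum, sum_dataCost] at hO
    simp only [sum_dataCost] at hE
    have hrisk : ∑ t, p D t * empRisk ℓ (cutFun d 0 1 t) D = 1 / (n : ℝ) *
        ∑ t, p D t * ∑ i, ℓ (cutFun d 0 1 t (D i).1) (D i).2 := by
      rw [Finset.mul_sum]
      refine Finset.sum_congr rfl fun t _ => ?_
      unfold empRisk; ring
    rw [hrisk]
    unfold empRisk
    have hmul := mul_le_mul_of_nonneg_left (hE.trans (add_le_add_left hO _))
      (by positivity : 0 ≤ 1 / (n : ℝ))
    refine sub_le_iff_le_add.2 (hmul.trans_eq ?_)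
    rw [hη_def]
    field_simp
    ring

/-- A constant predictor has excess risk at most the Lipschitz constant. -/
theorem exists_dp_isoRegAlg_const {ℓ : ℝ → ℝ → ℝ} {L : ℝ} (hL : 0 ≤ L)
    (hℓ : IsLipschitzLoss ℓ L) (hn : 1 ≤ n) {ε : ℝ} (hε : 0 < ε) :
    ∃ M : (Fin n → X × ℝ) → Measure (X → ℝ),
      IsIsoRegAlg M ∧ IsDP NeighborDS M ε 0 ∧
      ∀ D : Fin n → X × ℝ, IsDataset D → (∫ f, empRisk ℓ f D ∂(M D)) - optRisk ℓ D ≤ L := by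
  have hn0 : (0 : ℝ) < n := by exact_mod_cast hn
  have hzero : IsMonotone01 (fun _ : X => (0 : ℝ)) :=
    ⟨monotone_const, fun _ => ⟨le_rfl, zero_le_one⟩⟩
  refine ⟨fun _ => Measure.dirac fun _ => 0, fun D _ => ⟨inferInstance, ?_⟩, ?_, ?_⟩
  · rw [Measure.dirac_apply, Set.indicator_of_mem (s := {f : X → ℝ | IsMonotone01 f}) hzero,
      Pi.one_apply]
  · intro D D' _ S _
    rw [ENNReal.ofReal_zero, add_zero]
    exact le_mul_of_one_le_left zero_le (by simpa using hε.le)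
  · intro D hD
    rw [integral_dirac, sub_le_iff_le_add, ← sub_le_iff_le_add']
    have : Nonempty {g : X → ℝ // IsMonotone01 g} := ⟨⟨_, hzero⟩⟩
    refine le_ciInf fun ⟨g, hg⟩ => ?_
    have hterm : ∀ i, ℓ 0 (D i).2 ≤ ℓ (g (D i).1) (D i).2 + L := by
      intro i
      have hgi := hg.2 (D i).1
      have h := (abs_le.1 (hℓ.2 0 (g (D i).1) _ ⟨le_rfl, zero_le_one⟩ hgi (hD i))).2
      have h2 : |0 - g (D i).1| ≤ 1 := by
        rw [abs_le]; constructor <;> linarith [hgi.1, hgi.2]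
      nlinarith [mul_le_mul_of_nonneg_left h2 hL]
    have hs := Finset.sum_le_sum fun i (_ : i ∈ Finset.univ) => hterm i
    rw [Finset.sum_add_distrib, Finset.sum_const, Finset.card_univ, Fintype.card_fin,
      nsmul_eq_mul] at hs
    have := mul_le_mul_of_nonneg_left hs (by positivity : 0 ≤ 1 / (n : ℝ))
    unfold empRisk
    rw [mul_add, ← mul_assoc, one_div_mul_cancel hn0.ne', one_mul] at this
    linarith

end Dataset

instance DisjChains.instFintype (w h : ℕ) : Fintype (DisjChains w h) :=
  inferInstanceAs (Fintype (Fin h ⊕ Fin (w - 1)))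

lemma card_upperSet_disjChains_le (w h : ℕ) :
    Fintype.card (UpperSet (DisjChains w h)) ≤ (h + 1) * 2 ^ (w - 1) := by
  classical
  let chain : UpperSet (DisjChains w h) → Finset (Fin h) :=
    fun U => {i | (Sum.inl i : Fin h ⊕ Fin (w - 1)) ∈ (U : Set (DisjChains w h))}
  let single : UpperSet (DisjChains w h) → Finset (Fin (w - 1)) :=
    fun U => {j | (Sum.inr j : Fin h ⊕ Fin (w - 1)) ∈ (U : Set (DisjChains w h))}
  have hchain : ∀ U, IsUpperSet (chain U : Set (Fin h)) := by
    intro U i j hij hi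
    simp only [chain, Finset.coe_filter, Finset.mem_univ, true_and, Set.mem_ofPred_eq] at hi ⊢
    exact U.upper (Or.inr ⟨i, j, rfl, rfl, hij⟩) hi
  let φ : UpperSet (DisjChains w h) → Fin (h + 1) × Finset (Fin (w - 1)) := fun U =>
    (⟨(chain U).card, Nat.lt_succ_of_le ((Finset.card_le_univ _).trans_eq (Fintype.card_fin h))⟩,
      single U)
  have hφ : Function.Injective φ := by
    intro U V hUV
    have hcard : (chain U).card = (chain V).card := by
      simpa [φ] using congrArg (fun z => (z.1 : ℕ)) hUV
    have hs : single U = single V := congrArg Prod.snd hUV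
    have hc : chain U = chain V := by
      rcases (hchain U).total (hchain V) with h1 | h1
      · exact Finset.eq_of_subset_of_card_le (by exact_mod_cast h1) hcard.ge
      · exact (Finset.eq_of_subset_of_card_le (by exact_mod_cast h1) hcard.le).symm
    refine SetLike.coe_injective (Set.ext fun x => ?_)
    rcases x with i | j
    · have := Finset.ext_iff.1 hc i
      simp only [chain, Finset.mem_filter_univ] at this
      exact this
    · have := Finset.ext_iff.1 hs j
      simp only [single, Finset.mem_filter_univ] at this
      exact this
  simpa using Fintype.card_le_of_injective φ hφ

lemma log_card_upperSet_disjChains_le {w h : ℕ} (hw : 1 ≤ w) (hh : 2 ≤ h) :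
    Real.log (Fintype.card (UpperSet (DisjChains w h))) ≤ 2 * (w + Real.log h) := by
  have hh' : (2 : ℝ) ≤ h := by exact_mod_cast hh
  have hcard : (Fintype.card (UpperSet (DisjChains w h)) : ℝ) ≤ h ^ 2 * 2 ^ w := by
    have h1 : (Fintype.card (UpperSet (DisjChains w h)) : ℝ) ≤ (h + 1) * 2 ^ (w - 1) := by
      exact_mod_cast card_upperSet_disjChains_le w h
    refine h1.trans (mul_le_mul (by nlinarith) ?_ (by positivity) (by positivity))
    exact pow_le_pow_right₀ (by norm_num) (Nat.sub_le _ _)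
  have hpos : (0 : ℝ) < Fintype.card (UpperSet (DisjChains w h)) := by
    exact_mod_cast Fintype.card_pos
  refine (Real.log_le_log hpos hcard).trans ?_
  rw [Real.log_mul (by positivity) (by positivity), Real.log_pow, Real.log_pow]
  have hw0 : (0 : ℝ) ≤ w := by positivity
  push_cast
  nlinarith [Real.log_two_lt_d9]

/-- **Tight lower-bound example (disjoint chains).** There is a universal constant
`C > 0` such that for the poset of `w` disjoint chains `C₁, …, C_w` with `|C₁| = h ≥ 2`
and `|C₂| = ⋯ = |C_w| = 1` (`w ≥ 1`), any `L`-Lipschitz loss `ℓ`, any `n ≥ 1` and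
`ε ∈ (0,1]`, there is an `ε`-DP isotonic-regression mechanism with expected excess
empirical risk at most `C · L · (w + log h) · (1 + log²(εn)) / (εn)`. -/
theorem dp_isotonic_regression_disjoint_chains_upper_bound :
    ∃ C : ℝ, 0 < C ∧
      ∀ w h : ℕ, 1 ≤ w → 2 ≤ h →
        ∀ (ℓ : ℝ → ℝ → ℝ) (L : ℝ), IsLipschitzLoss ℓ L →
        ∀ n : ℕ, 1 ≤ n →
        ∀ ε : ℝ, ε ∈ Set.Ioc (0 : ℝ) 1 →
        ∃ M : (Fin n → DisjChains w h × ℝ) → Measure (DisjChains w h → ℝ),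
          IsIsoRegAlg M ∧
          IsDP NeighborDS M ε 0 ∧
          ∀ D : Fin n → DisjChains w h × ℝ, IsDataset D →
            (∫ f, empRisk ℓ f D ∂(M D)) - optRisk ℓ D ≤
              C * L * ((w : ℝ) + Real.log h) * (1 + Real.log (ε * n) ^ 2) / (ε * n) := by
  refine ⟨33, by norm_num, fun w h hw hh ℓ L hℓ n hn ε hε => ?_⟩
  have hw1 : (1 : ℝ) ≤ w := by exact_mod_cast hw
  have hn0 : (0 : ℝ) < n := by exact_mod_cast hn
  have hlogh : 0 ≤ Real.log h := Real.log_nonneg (by exact_mod_cast (by omega : 1 ≤ h))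
  have hN : 0 < ε * n := mul_pos hε.1 hn0
  have hL : 0 ≤ L := by
    have := hℓ.2 0 1 0 (by simp) (by simp) (by simp)
    norm_num at this
    exact (abs_nonneg _).trans this
  have hfac : 1 ≤ (w + Real.log h) * (1 + Real.log (ε * n) ^ 2) :=
    one_le_mul_of_one_le_of_one_le (by linarith) (by nlinarith [sq_nonneg (Real.log (ε * n))])
  by_cases hcase : 0 < L ∧ 1 ≤ ε * n
  · obtain ⟨hLpos, hN1⟩ := hcase
    set d := ⌊Real.logb 2 (ε * n)⌋₊ + 1 with hd
    obtain ⟨M, hM, hDP, hrisk⟩ := exists_dp_isoRegAlg (X := DisjChains w h) hLpos hℓ hn hε.1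
      (d := d) (by omega)
    refine ⟨M, hM, hDP, fun D hD => (hrisk D hD).trans ?_⟩
    have hlogN : 0 ≤ Real.log (ε * n) := Real.log_nonneg hN1
    have hlogb : 0 ≤ Real.logb 2 (ε * n) := Real.logb_nonneg (by norm_num) hN1
    have hpow : ε * n ≤ 2 ^ d := by
      have hlt : Real.logb 2 (ε * n) < d := by
        rw [hd]; exact_mod_cast Nat.lt_floor_add_one (Real.logb 2 (ε * n))
      rw [Real.logb_lt_iff_lt_rpow (by norm_num) hN, Real.rpow_natCast] at hlt
      exact hlt.le
    have hd_le : (d : ℝ) ≤ 1 + 2 * Real.log (ε * n) := by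
      have h1 : (⌊Real.logb 2 (ε * n)⌋₊ : ℝ) ≤ Real.logb 2 (ε * n) := Nat.floor_le hlogb
      have h2 : Real.logb 2 (ε * n) ≤ 2 * Real.log (ε * n) := by
        rw [Real.logb, div_le_iff₀ (Real.log_pos (by norm_num))]
        nlinarith [Real.log_two_gt_d9]
      rw [hd]; push_cast; linarith
    have hd_sq : (d : ℝ) ^ 2 ≤ 8 * (1 + Real.log (ε * n) ^ 2) := by
      have : (d : ℝ) ^ 2 ≤ (1 + 2 * Real.log (ε * n)) ^ 2 :=
        pow_le_pow_left₀ (by positivity) hd_le 2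
      nlinarith [sq_nonneg (1 - 2 * Real.log (ε * n))]
    have hlast : L / 2 ^ d ≤ L / (ε * n) := div_le_div_of_nonneg_left hL hN hpow
    have hprod : (d : ℝ) ^ 2 * Real.log (Fintype.card (UpperSet (DisjChains w h))) ≤
        8 * (1 + Real.log (ε * n) ^ 2) * (2 * (w + Real.log h)) :=
      mul_le_mul hd_sq (log_card_upperSet_disjChains_le hw hh)
        (Real.log_natCast_nonneg _) (by positivity)
    refine (add_le_add_right hlast _).trans ?_
    rw [← add_div]
    refine div_le_div_of_nonneg_right ?_ hN.le
    nlinarith [mul_le_mul_of_nonneg_left hprod hL, mul_le_mul_of_nonneg_left hfac hL]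
  · obtain ⟨M, hM, hDP, hrisk⟩ :=
      exists_dp_isoRegAlg_const (X := DisjChains w h) hL hℓ hn hε.1
    refine ⟨M, hM, hDP, fun D hD => (hrisk D hD).trans ?_⟩
    rw [le_div_iff₀ hN]
    rcases hL.eq_or_lt with h0 | hpos
    · simp [← h0]
    · have hlt : ε * n < 1 := not_le.1 fun h' => hcase ⟨hpos, h'⟩
      nlinarith [mul_le_mul_of_nonneg_left hfac hL, mul_le_mul_of_nonneg_left hlt.le hL]
end
end
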